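/- arXiv:q-alg/9610033 — 3 statements merged into one kernel-verified Lean document; each statement's English description precedes it below -/
import Mathlib

section
/- Fix integers k ≥ 1, l ≥ 1 and m ≥ 0, and let ρ = (k−1, k−2, …, 1, 0) ∈ ℤ^k. Let y ∈ ℤ^k be dominant with every coordinate divisible by l and with Σ_{i=1}^{k} y_i = l·Σ_{i=1}^{k} ρ_i + m·l. Then the map Ψ sending a path p to the path j ↦ p(j·l)/l (for 0 ≤ j ≤ m) is a well-defined bijection from the set of l-straight dominant increasing lattice paths of length m·l from l·ρ to y, onto the set of dominant increasing lattice paths of length m from ρ to y/l. Well-definedness includes the assertions that for every such p and every 0 ≤ j ≤ m, all coordinates of p(j·l) are divisible by l, the point p(j·l)/l is dominant, and p((j+1)·l) − p(j·l) = l·e_a for a single index a. -/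
/-- The `a`-th standard basis vector of `ℤ^k`. -/
def stepVec (k : ℕ) (a : Fin k) : Fin k → ℤ := fun c => if c = a then 1 else 0

/-- An increasing lattice path of length `N` in `ℤ^k`. -/
def IsLatticePath {k N : ℕ} (p : Fin (N + 1) → Fin k → ℤ) : Prop :=
  ∀ j : Fin N, ∃ a : Fin k, p j.succ = p j.castSucc + stepVec k a

/-- The vector `ρ = (k-1, k-2, …, 1, 0) ∈ ℤ^k`. -/
def rho (k : ℕ) : Fin k → ℤ := fun c => (k : ℤ) - 1 - (c : ℕ)

/-- Strictly decreasing coordinates. -/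
def Dominant {k : ℕ} (v : Fin k → ℤ) : Prop := ∀ i j : Fin k, i < j → v j < v i

/-- The index `j·l` viewed in `Fin (m·l + 1)`, for `j : Fin (m+1)`. -/
def emb (m l : ℕ) (j : Fin (m + 1)) : Fin (m * l + 1) :=
  ⟨(j : ℕ) * l, Nat.lt_succ_of_le (Nat.mul_le_mul_right l (Nat.lt_succ_iff.mp j.isLt))⟩

/-- The map `Ψ`, sending a path `p` of length `m·l` to the path `j ↦ p(j·l)/l`. -/
def Psi (k m l : ℕ) (p : Fin (m * l + 1) → Fin k → ℤ) : Fin (m + 1) → Fin k → ℤ :=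
  fun j c => p (emb m l j) c / (l : ℤ)

/-- The set of `l`-straight dominant increasing lattice paths of length `m·l` from
`l·ρ` to `y`. -/
def SetA (k l m : ℕ) (y : Fin k → ℤ) : Set (Fin (m * l + 1) → Fin k → ℤ) :=
  {p | IsLatticePath p ∧ (∀ j, Dominant (p j)) ∧
    p 0 = (fun c => (l : ℤ) * rho k c) ∧
    (∀ j : Fin (m * l), ∀ a : Fin k,
      p j.succ = p j.castSucc + stepVec k a →
      p j.succ a ≡ ((j : ℕ) + 1 : ℤ) [ZMOD (l : ℤ)]) ∧
    p (Fin.last (m * l)) = y}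

/-- The set of dominant increasing lattice paths of length `m` from `ρ` to `y/l`. -/
def SetB (k l m : ℕ) (y : Fin k → ℤ) : Set (Fin (m + 1) → Fin k → ℤ) :=
  {t | IsLatticePath t ∧ (∀ j, Dominant (t j)) ∧
    t 0 = rho k ∧ t (Fin.last m) = fun c => y c / (l : ℤ)}

theorem stepVec_self {k : ℕ} (a : Fin k) : stepVec k a a = 1 := by simp [stepVec]

theorem stepVec_injective {k : ℕ} {a b : Fin k} (h : stepVec k a = stepVec k b) : a = b := by
  by_contra hab
  have := congrFun h a
  simp [stepVec, hab] at this

/-- Starting from a vector divisible by `l`, the next `l` steps of an `l`-straight path all raise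
the same coordinate. -/
theorem exists_block {k l : ℕ} (q : ℕ → Fin k → ℤ) (s : ℕ) (hl : 1 ≤ l)
    (hdiv : ∀ c, (l : ℤ) ∣ q s c)
    (hstep : ∀ r < l, ∃ a, q (s + r + 1) = q (s + r) + stepVec k a ∧
      q (s + r + 1) a ≡ (r : ℤ) + 1 [ZMOD (l : ℤ)]) :
    ∃ a, ∀ r ≤ l, q (s + r) = q s + (r : ℤ) • stepVec k a := by
  obtain ⟨a, ha, -⟩ := hstep 0 (by omega)
  refine ⟨a, fun r => ?_⟩
  induction r with
  | zero => intro _; simp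
  | succ r ih =>
    intro hr
    have ih := ih (by omega)
    obtain ⟨b, hb, hmod⟩ := hstep r (by omega)
    have hba : b = a := by
      rcases Nat.eq_zero_or_pos r with rfl | hr0
      · exact stepVec_injective (add_left_cancel (hb.symm.trans ha))
      · by_contra hne
        have hv : q (s + r + 1) b = q s b + 1 := by
          rw [hb, ih]; simp [stepVec, hne]
        rw [hv] at hmod
        have h1 : (l : ℤ) ∣ (r : ℤ) + 1 - (q s b + 1) := hmod.dvd
        have h2 : (l : ℤ) ∣ (r : ℤ) := by
          have := dvd_add h1 (hdiv b)
          ring_nf at this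
          exact this
        have := Nat.le_of_dvd hr0 (Int.natCast_dvd_natCast.mp h2)
        omega
    subst hba
    rw [← add_assoc, hb, ih]
    push_cast
    rw [add_smul, one_smul, add_assoc]

/-- Extension of a finite path to all natural times. -/
def extend {k N : ℕ} (p : Fin (N + 1) → Fin k → ℤ) (n : ℕ) : Fin k → ℤ := p (Fin.ofNat (N + 1) n)

theorem extend_eq {k N : ℕ} (p : Fin (N + 1) → Fin k → ℤ) {n : ℕ} (j : Fin (N + 1))
    (h : (j : ℕ) = n) : extend p n = p j := by
  subst h
  simp [extend]

theorem extend_block {k l m : ℕ} {y : Fin k → ℤ} (hl : 1 ≤ l) {p : Fin (m * l + 1) → Fin k → ℤ}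
    (hp : p ∈ SetA k l m y) {j : ℕ} (hj : j < m) (hdiv : ∀ c, (l : ℤ) ∣ extend p (j * l) c) :
    ∃ a, ∀ r ≤ l, extend p (j * l + r) = extend p (j * l) + (r : ℤ) • stepVec k a := by
  obtain ⟨hpath, -, -, hstr, -⟩ := hp
  refine exists_block _ _ hl hdiv fun r hr => ?_
  have hlt : j * l + r < m * l := by nlinarith
  obtain ⟨a, ha⟩ := hpath ⟨j * l + r, hlt⟩
  have hs := hstr _ a ha
  rw [extend_eq p (n := j * l + r + 1) (Fin.succ ⟨j * l + r, hlt⟩) rfl,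
    extend_eq p (n := j * l + r) (Fin.castSucc ⟨j * l + r, hlt⟩) rfl]
  refine ⟨a, ha, hs.trans ?_⟩
  rw [Int.modEq_iff_dvd]
  exact ⟨-j, by push_cast; ring⟩

theorem dvd_extend {k l m : ℕ} {y : Fin k → ℤ} (hl : 1 ≤ l) {p : Fin (m * l + 1) → Fin k → ℤ}
    (hp : p ∈ SetA k l m y) {j : ℕ} (hj : j ≤ m) (c : Fin k) :
    (l : ℤ) ∣ extend p (j * l) c := by
  induction j generalizing c with
  | zero =>
    rw [extend_eq p 0 (by simp), hp.2.2.1]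
    exact dvd_mul_right _ _
  | succ j ih =>
    obtain ⟨a, ha⟩ := extend_block hl hp hj (ih (by omega))
    rw [Nat.succ_mul, ha l le_rfl]
    exact dvd_add (ih (by omega) c) (dvd_mul_right _ _)

theorem dvd_emb {k l m : ℕ} {y : Fin k → ℤ} (hl : 1 ≤ l) {p : Fin (m * l + 1) → Fin k → ℤ}
    (hp : p ∈ SetA k l m y) (j : Fin (m + 1)) (c : Fin k) : (l : ℤ) ∣ p (emb m l j) c := by
  rw [← extend_eq p (n := j * l) (emb m l j) rfl]
  exact dvd_extend hl hp (Nat.le_of_lt_succ j.isLt) c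

theorem exists_emb_succ {k l m : ℕ} {y : Fin k → ℤ} (hl : 1 ≤ l)
    {p : Fin (m * l + 1) → Fin k → ℤ} (hp : p ∈ SetA k l m y) (j : Fin m) :
    ∃ a, p (emb m l j.succ) = p (emb m l j.castSucc) + (l : ℤ) • stepVec k a := by
  obtain ⟨a, ha⟩ := extend_block hl hp j.isLt (dvd_extend hl hp j.isLt.le)
  refine ⟨a, ?_⟩
  rw [← extend_eq p (n := j * l + l) (emb m l j.succ) (by simp [emb, Nat.succ_mul]),
    ← extend_eq p (n := j * l) (emb m l j.castSucc) rfl]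
  exact ha l le_rfl

theorem dominant_ediv {k l : ℕ} (hl : 1 ≤ l) {v : Fin k → ℤ} (hv : Dominant v)
    (hdiv : ∀ c, (l : ℤ) ∣ v c) : Dominant (fun c => v c / (l : ℤ)) := fun i j hij =>
  Int.ediv_lt_of_lt_mul (by omega) (by rw [Int.ediv_mul_cancel (hdiv i)]; exact hv i j hij)

theorem Psi_mem {k l m : ℕ} {y : Fin k → ℤ} (hl : 1 ≤ l) {p : Fin (m * l + 1) → Fin k → ℤ}
    (hp : p ∈ SetA k l m y) : Psi k m l p ∈ SetB k l m y := by
  have hl0 : (l : ℤ) ≠ 0 := by omega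
  refine ⟨fun j => ?_, fun j => dominant_ediv hl (hp.2.1 _) (dvd_emb hl hp j), ?_, ?_⟩
  · obtain ⟨a, ha⟩ := exists_emb_succ hl hp j
    refine ⟨a, funext fun c => ?_⟩
    simp only [Psi, ha, Pi.add_apply, Pi.smul_apply, smul_eq_mul]
    exact Int.add_mul_ediv_left _ _ hl0
  · funext c
    have : emb m l 0 = 0 := by simp [emb]
    simp only [Psi, this, hp.2.2.1]
    exact Int.mul_ediv_cancel_left _ hl0
  · funext c
    have : emb m l (Fin.last m) = Fin.last (m * l) := rfl
    simp only [Psi, this, hp.2.2.2.2]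

/-- Piecewise linear interpolation of `l • t` on a time scale refined by the factor `l`. -/
def interpolate {k : ℕ} (l : ℕ) (t : ℕ → Fin k → ℤ) (n : ℕ) : Fin k → ℤ := fun c =>
  (l : ℤ) * t (n / l) c + ((n % l : ℕ) : ℤ) * (t (n / l + 1) c - t (n / l) c)

theorem interpolate_mul_add {k l : ℕ} (hl : 1 ≤ l) (t : ℕ → Fin k → ℤ) (j : ℕ) {r : ℕ}
    (hr : r ≤ l) (c : Fin k) :
    interpolate l t (j * l + r) c = (l : ℤ) * t j c + (r : ℤ) * (t (j + 1) c - t j c) := by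
  rcases hr.lt_or_eq with hr | rfl
  · have h1 : (j * l + r) / l = j := by
      rw [mul_comm, Nat.mul_add_div (by omega), Nat.div_eq_of_lt hr, add_zero]
    have h2 : (j * l + r) % l = r := by
      rw [mul_comm, Nat.mul_add_mod, Nat.mod_eq_of_lt hr]
    simp only [interpolate, h1, h2]
  · rw [← Nat.succ_mul]
    have h1 : (j + 1) * r / r = j + 1 := Nat.mul_div_cancel _ hl
    simp only [interpolate, Nat.succ_eq_add_one, h1, Nat.mul_mod_left]
    push_cast
    ring

theorem interpolate_mul {k l : ℕ} (hl : 1 ≤ l) (t : ℕ → Fin k → ℤ) (j : ℕ) (c : Fin k) :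
    interpolate l t (j * l) c = (l : ℤ) * t j c := by
  simpa using interpolate_mul_add hl t j (Nat.zero_le l) c

theorem exists_mul_add {l m n : ℕ} (hn : n < m * l) : ∃ j r, n = j * l + r ∧ j < m ∧ r < l := by
  have hl : 0 < l := Nat.pos_of_ne_zero (by rintro rfl; simp at hn)
  exact ⟨n / l, n % l, (Nat.div_add_mod' n l).symm, (Nat.div_lt_iff_lt_mul hl).mpr hn,
    Nat.mod_lt n hl⟩

theorem interpolate_mem {k l m : ℕ} {y : Fin k → ℤ} (hl : 1 ≤ l) (hdiv : ∀ c, (l : ℤ) ∣ y c)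
    {t : Fin (m + 1) → Fin k → ℤ} (ht : t ∈ SetB k l m y) :
    (fun n : Fin (m * l + 1) => interpolate l (extend t) n) ∈ SetA k l m y := by
  obtain ⟨hpath, hdom, h0, hlast⟩ := ht
  have hstep : ∀ n : Fin (m * l), ∃ a,
      interpolate l (extend t) (n + 1) = interpolate l (extend t) n + stepVec k a ∧
      interpolate l (extend t) (n + 1) a ≡ ((n : ℕ) : ℤ) + 1 [ZMOD (l : ℤ)] := by
    rintro ⟨n, hn⟩
    obtain ⟨j, r, rfl, hj, hr⟩ := exists_mul_add hn
    obtain ⟨a, ha⟩ := hpath ⟨j, hj⟩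
    rw [← extend_eq t (n := j + 1) (Fin.succ ⟨j, hj⟩) rfl,
      ← extend_eq t (n := j) (Fin.castSucc ⟨j, hj⟩) rfl] at ha
    refine ⟨a, funext fun c => ?_, ?_⟩
    · rw [Pi.add_apply, add_assoc, interpolate_mul_add hl _ _ hr,
        interpolate_mul_add hl _ _ hr.le, ha, Pi.add_apply]
      push_cast
      ring
    · simp only [add_assoc]
      rw [interpolate_mul_add hl _ _ hr, ha, Pi.add_apply, stepVec_self, Int.modEq_iff_dvd]
      exact ⟨j - extend t j a, by push_cast; ring⟩
  refine ⟨fun n => ?_, fun n c d hcd => ?_, funext fun c => ?_, fun n a ha => ?_,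
    funext fun c => ?_⟩
  · obtain ⟨a, ha, -⟩ := hstep n
    exact ⟨a, ha⟩
  · have hlt : ∀ j, extend t j d < extend t j c := fun j => hdom _ c d hcd
    have hlpos : (0 : ℤ) < l := by omega
    have hmod : (((n : ℕ) % l : ℕ) : ℤ) < l := by exact_mod_cast Nat.mod_lt _ hl
    have h1 := mul_pos (sub_pos.mpr hmod) (sub_pos.mpr (hlt (n / l)))
    have h2 := mul_nonneg (Int.natCast_nonneg ((n : ℕ) % l)) (sub_pos.mpr (hlt (n / l + 1))).le
    simp only [interpolate]
    linarith
  · have := interpolate_mul hl (extend t) 0 c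
    rw [extend_eq t (n := 0) 0 rfl, h0, zero_mul] at this
    exact this
  · obtain ⟨b, hb, hmod⟩ := hstep n
    obtain rfl : a = b := stepVec_injective (add_left_cancel (ha.symm.trans hb))
    exact hmod
  · have := interpolate_mul hl (extend t) m c
    rw [extend_eq t (n := m) (Fin.last m) rfl, hlast, Int.mul_ediv_cancel' (hdiv c)] at this
    exact this

theorem Psi_interpolate {k l m : ℕ} (hl : 1 ≤ l) (t : Fin (m + 1) → Fin k → ℤ) :
    Psi k m l (fun n : Fin (m * l + 1) => interpolate l (extend t) n) = t := by
  funext j c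
  simp only [Psi, emb]
  rw [interpolate_mul hl, extend_eq t j rfl, Int.mul_ediv_cancel_left _ (by omega)]

theorem interpolate_Psi {k l m : ℕ} {y : Fin k → ℤ} (hl : 1 ≤ l)
    {p : Fin (m * l + 1) → Fin k → ℤ} (hp : p ∈ SetA k l m y) :
    (fun n : Fin (m * l + 1) => interpolate l (extend (Psi k m l p)) n) = p := by
  have key : ∀ j ≤ m, ∀ c, (l : ℤ) * extend (Psi k m l p) j c = extend p (j * l) c := by
    intro j hj c
    rw [extend_eq _ (n := j) ⟨j, Nat.lt_succ_of_le hj⟩ rfl,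
      extend_eq p (n := j * l) (emb m l ⟨j, Nat.lt_succ_of_le hj⟩) rfl]
    exact Int.mul_ediv_cancel' (dvd_emb hl hp _ c)
  funext n c
  rcases (Nat.le_of_lt_succ n.isLt).lt_or_eq with hn | hn
  · obtain ⟨j, r, hjr, hj, hr⟩ := exists_mul_add hn
    obtain ⟨a, ha⟩ := extend_block hl hp hj (dvd_extend hl hp hj.le)
    have hinc : extend (Psi k m l p) (j + 1) c - extend (Psi k m l p) j c = stepVec k a c := by
      have hl0 : (l : ℤ) ≠ 0 := by omega
      apply mul_left_cancel₀ hl0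
      rw [mul_sub, key _ hj, key _ hj.le, Nat.succ_mul, ha l le_rfl]
      simp
    rw [hjr, interpolate_mul_add hl _ _ hr.le, key _ hj.le, hinc, ← extend_eq p n hjr, ha r hr.le]
    simp
  · rw [hn, interpolate_mul hl, key _ le_rfl, extend_eq p n hn]

/-- For `y` dominant with all coordinates divisible by `l` and
`∑ y = l·∑ρ + m·l`, the map `Ψ : p ↦ (j ↦ p(j·l)/l)` is a well-defined bijection from
the set of `l`-straight dominant increasing lattice paths of length `m·l` from `l·ρ`
to `y` onto the set of dominant increasing lattice paths of length `m` from `ρ` to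
`y/l`; moreover, for `p` in the source, all coordinates of every `p(j·l)` are divisible
by `l`, each `p(j·l)/l` is dominant, and `p((j+1)·l) - p(j·l) = l·e_a` for a single
index `a`. -/
theorem stmt_12 (k l m : ℕ) (hk : 1 ≤ k) (hl : 1 ≤ l)
    (y : Fin k → ℤ) (hdom : Dominant y) (hdiv : ∀ c, (l : ℤ) ∣ y c)
    (hsum : (∑ c, y c) = (l : ℤ) * (∑ c, rho k c) + (m : ℤ) * l) :
    (∀ p ∈ SetA k l m y, ∀ j : Fin (m + 1),
      (∀ c, (l : ℤ) ∣ p (emb m l j) c) ∧ Dominant (fun c => p (emb m l j) c / (l : ℤ))) ∧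
    (∀ p ∈ SetA k l m y, ∀ j : Fin m, ∃ a : Fin k,
      p (emb m l j.succ) = p (emb m l j.castSucc) + (l : ℤ) • stepVec k a) ∧
    Set.BijOn (Psi k m l) (SetA k l m y) (SetB k l m y) := by
  refine ⟨fun p hp j => ⟨dvd_emb hl hp j, dominant_ediv hl (hp.2.1 _) (dvd_emb hl hp j)⟩,
    fun p hp j => exists_emb_succ hl hp j, fun p hp => Psi_mem hl hp, fun p hp q hq hpq => ?_,
    fun t ht => ⟨_, interpolate_mem hl hdiv ht, Psi_interpolate hl t⟩⟩
  rw [← interpolate_Psi hl hp, ← interpolate_Psi hl hq, hpq]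
end

section
/- Fix integers k ≥ 1 and l ≥ 2. Let y ∈ ℤ^k be dominant and let i, m ≥ 0 be integers with i + m ≤ k. Assume y_j ≡ y_1 (mod l) for every 1 ≤ j ≤ i, and that exactly i + m indices j ∈ {1,…,k} satisfy y_j ≡ y_1 (mod l). Let 𝒫 be the set of dominant increasing lattice paths p of length i in ℤ^k with p(0) = y such that at every step the coordinate being incremented has, before the increment, a value congruent to y_1 modulo l. Let e^{(i)} ∈ ℤ^k denote the vector whose first i coordinates are 1 and whose remaining coordinates are 0. Then: (a) every p ∈ 𝒫 ends at a point p(i) that is equal to y + e^{(i)} or lexicographically smaller than y + e^{(i)}; (b) the cardinality of 𝒫 is at most (m+i)!/m!; (c) exactly i! elements of 𝒫 end at y + e^{(i)}. -/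
/-- The vector `e^{(i)} ∈ ℤ^k` whose first `i` coordinates are `1` and whose remaining
coordinates are `0`. -/
def eVec (k i : ℕ) : Fin k → ℤ := fun c => if (c : ℕ) < i then 1 else 0

/-- Strict lexicographic order on `ℤ^k` (compare at the first differing coordinate). -/
def LexLt {k : ℕ} (u v : Fin k → ℤ) : Prop :=
  ∃ j : Fin k, u j < v j ∧ ∀ c : Fin k, c < j → u c = v c

/-- The set `𝒫` of dominant increasing lattice paths of length `i` starting at `y`
such that at every step the coordinate being incremented has, before the increment, a
value congruent to `y_1` modulo `l`. -/
def PathSet (k l i : ℕ) (hk : 0 < k) (y : Fin k → ℤ) :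
    Set (Fin (i + 1) → Fin k → ℤ) :=
  {p | IsLatticePath p ∧ (∀ j, Dominant (p j)) ∧ p 0 = y ∧
    ∀ j : Fin i, ∀ a : Fin k,
      p j.succ = p j.castSucc + stepVec k a →
      p j.castSucc a ≡ y ⟨0, hk⟩ [ZMOD (l : ℤ)]}

/-- The sequence of points starting at `y` that increments the coordinates listed by `a` in turn,
each coordinate at most once. -/
noncomputable def pathOf {k i : ℕ} (y : Fin k → ℤ) (a : Fin i → Fin k) :
    Fin (i + 1) → Fin k → ℤ :=
  open Classical in
  fun j c => y c + if ∃ t : Fin i, t.castSucc < j ∧ a t = c then 1 else 0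

theorem pathOf_zero {k i : ℕ} (y : Fin k → ℤ) (a : Fin i → Fin k) : pathOf y a 0 = y := by
  funext c
  simp [pathOf]

theorem pathOf_castSucc_self {k i : ℕ} (y : Fin k → ℤ) {a : Fin i → Fin k}
    (ha : Function.Injective a) (j : Fin i) : pathOf y a j.castSucc (a j) = y (a j) := by
  unfold pathOf
  rw [if_neg, add_zero]
  rintro ⟨t, ht, hat⟩
  rw [ha hat] at ht
  exact lt_irrefl _ ht

theorem pathOf_succ {k i : ℕ} (y : Fin k → ℤ) {a : Fin i → Fin k}
    (ha : Function.Injective a) (j : Fin i) :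
    pathOf y a j.succ = pathOf y a j.castSucc + stepVec k (a j) := by
  funext c
  by_cases hc : c = a j
  · subst hc
    rw [Pi.add_apply, pathOf_castSucc_self y ha]
    unfold pathOf stepVec
    rw [if_pos ⟨j, Fin.castSucc_lt_succ, rfl⟩, if_pos rfl]
  · have h : (∃ t : Fin i, t.castSucc < j.succ ∧ a t = c) ↔
        ∃ t : Fin i, t.castSucc < j.castSucc ∧ a t = c := by
      refine exists_congr fun t => and_congr_left fun hat => ?_
      have htj : t ≠ j := fun h => hc (by rw [← hat, h])
      rw [Fin.lt_def, Fin.lt_def]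
      have := Fin.val_ne_of_ne htj
      simp only [Fin.val_castSucc, Fin.val_succ]
      omega
    simp only [pathOf, stepVec, h, hc, Pi.add_apply, if_false, add_zero]

theorem pathOf_last {k i : ℕ} (y : Fin k → ℤ) (a : Fin i → Fin k) (c : Fin k)
    [Decidable (c ∈ Set.range a)] :
    pathOf y a (Fin.last i) c = y c + if c ∈ Set.range a then 1 else 0 := by
  simp [pathOf, Fin.castSucc_lt_last]

theorem stepVec_injective_s13 (k : ℕ) : Function.Injective (stepVec k) := by
  intro a b h
  by_contra hab
  have := congrFun h a
  simp [stepVec, hab] at this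

theorem pathOf_injOn {k i : ℕ} (y : Fin k → ℤ) :
    Set.InjOn (pathOf y) {a : Fin i → Fin k | Function.Injective a} := by
  intro a ha b hb h
  funext j
  refine stepVec_injective_s13 k (add_left_cancel (a := pathOf y a j.castSucc) ?_)
  rw [← pathOf_succ y ha, h, pathOf_succ y hb]

theorem not_modEq_succ {l : ℕ} (hl : 2 ≤ l) {x r : ℤ} (hx : x ≡ r [ZMOD (l : ℤ)]) :
    ¬ x + 1 ≡ r [ZMOD (l : ℤ)] := by
  intro h
  have h1 : (l : ℤ) ∣ x + 1 - x := (hx.trans h.symm).dvd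
  have := Int.le_of_dvd (by omega) h1
  omega

/-- Every path in `PathSet` increments each coordinate at most once. -/
theorem exists_eq_pathOf {k l i : ℕ} {hk : 0 < k} (hl : 2 ≤ l) {y : Fin k → ℤ}
    {p : Fin (i + 1) → Fin k → ℤ} (hp : p ∈ PathSet k l i hk y) :
    ∃ a : Fin i → Fin k, Function.Injective a ∧
      (∀ t, y (a t) ≡ y ⟨0, hk⟩ [ZMOD (l : ℤ)]) ∧ p = pathOf y a := by
  obtain ⟨hpath, -, h0, hmod⟩ := hp
  choose a ha using hpath
  have hmod' : ∀ j, p j.castSucc (a j) ≡ y ⟨0, hk⟩ [ZMOD (l : ℤ)] := fun j => hmod j _ (ha j)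
  have key : ∀ (j : Fin (i + 1)) (c : Fin k),
      (p j c = y c ∧ ∀ t : Fin i, t.castSucc < j → a t ≠ c) ∨
      (p j c = y c + 1 ∧ y c ≡ y ⟨0, hk⟩ [ZMOD (l : ℤ)] ∧
        ∃ t : Fin i, t.castSucc < j ∧ a t = c) := by
    intro j
    induction j using Fin.induction with
    | zero => exact fun c => Or.inl ⟨by rw [h0], fun t ht => absurd ht (Fin.not_lt_zero _)⟩
    | succ j ih =>
      intro c
      have hlt : ∀ t : Fin i, t.castSucc < j.castSucc → t.castSucc < j.succ :=
        fun t ht => ht.trans Fin.castSucc_lt_succ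
      by_cases hc : c = a j
      · subst hc
        right
        rcases ih (a j) with ⟨h1, -⟩ | ⟨h1, h2, -⟩
        · refine ⟨by simp [ha j, stepVec, h1], ?_, j, Fin.castSucc_lt_succ, rfl⟩
          rw [← h1]
          exact hmod' j
        · exact absurd (h1 ▸ hmod' j) (not_modEq_succ hl h2)
      · have hpc : p j.succ c = p j.castSucc c := by simp [ha j, stepVec, hc]
        rw [hpc]
        rcases ih c with ⟨h1, h2⟩ | ⟨h1, h2, t, ht, hat⟩
        · refine Or.inl ⟨h1, fun t ht hat => ?_⟩
          rcases Fin.lt_or_eq_of_le (Fin.le_castSucc_iff.2 ht) with h | h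
          · exact h2 t h hat
          · exact hc (by rw [← hat, Fin.castSucc_injective _ h])
        · exact Or.inr ⟨h1, h2, t, hlt t ht, hat⟩
  refine ⟨a, ?_, fun t => ?_, ?_⟩
  · refine Function.Injective.of_lt_imp_ne fun s t hst hat => ?_
    rcases key t.castSucc (a t) with ⟨-, h2⟩ | ⟨h1, h2, -⟩
    · exact h2 s hst hat
    · exact not_modEq_succ hl h2 (h1 ▸ hmod' t)
  · rcases key t.castSucc (a t) with ⟨h1, -⟩ | ⟨-, h2, -⟩
    · exact h1 ▸ hmod' t
    · exact h2
  · funext j c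
    unfold pathOf
    rcases key j c with ⟨h1, h2⟩ | ⟨h1, -, h3⟩
    · rw [h1, if_neg, add_zero]
      rintro ⟨t, ht, hat⟩
      exact h2 t ht hat
    · rw [h1, if_pos h3]

/-- Incrementing the first `i` coordinates once each, in any order, gives a path in `PathSet`. -/
theorem pathOf_mem_pathSet {k l i : ℕ} {hk : 0 < k} (hl : 2 ≤ l) {y : Fin k → ℤ}
    (hdom : Dominant y)
    (hfirst : ∀ j : Fin k, (j : ℕ) < i → y j ≡ y ⟨0, hk⟩ [ZMOD (l : ℤ)])
    {a : Fin i → Fin k} (ha : Function.Injective a) (hai : ∀ t, (a t : ℕ) < i) :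
    pathOf y a ∈ PathSet k l i hk y := by
  refine ⟨fun j => ⟨a j, pathOf_succ y ha j⟩, fun j b c hbc => ?_, pathOf_zero y a,
    fun j b hb => ?_⟩
  · have hlt := hdom b c hbc
    unfold pathOf
    by_cases hc : ∃ t : Fin i, t.castSucc < j ∧ a t = c
    · rw [if_pos hc]
      obtain ⟨t, -, rfl⟩ := hc
      have hdvd : (l : ℤ) ∣ y b - y (a t) :=
        ((hfirst _ (hai t)).trans (hfirst b (lt_trans hbc (hai t))).symm).dvd
      have := Int.le_of_dvd (by omega) hdvd
      split_ifs <;> omega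
    · rw [if_neg hc]
      split_ifs <;> omega
  · rw [pathOf_succ y ha j] at hb
    rw [← stepVec_injective_s13 k (add_left_cancel hb), pathOf_castSucc_self y ha]
    exact hfirst _ (hai j)

/-- If the incremented coordinates include the first `i` ones, they are exactly those. -/
theorem mem_range_iff_of_forall_lt {k i : ℕ} (hik : i ≤ k) {a : Fin i → Fin k}
    (ha : ∀ c : Fin k, (c : ℕ) < i → c ∈ Set.range a) (c : Fin k) :
    c ∈ Set.range a ↔ (c : ℕ) < i := by
  classical
  have hsub : Finset.univ.image (Fin.castLE hik) ⊆ Finset.univ.image a := by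
    intro c hc
    obtain ⟨t, -, rfl⟩ := Finset.mem_image.1 hc
    obtain ⟨s, hs⟩ := ha _ (show (Fin.castLE hik t : ℕ) < i from t.2)
    exact Finset.mem_image.2 ⟨s, Finset.mem_univ _, hs⟩
  have heq := Finset.eq_of_subset_of_card_le hsub (by
    rw [Finset.card_image_of_injective _ (Fin.castLE_injective hik)]
    exact Finset.card_image_le)
  refine ⟨?_, ha c⟩
  rintro ⟨t, rfl⟩
  have ht : a t ∈ Finset.univ.image (Fin.castLE hik) := by
    rw [heq]
    exact Finset.mem_image_of_mem _ (Finset.mem_univ _)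
  obtain ⟨s, -, hs⟩ := Finset.mem_image.1 ht
  rw [← hs]
  exact s.2

theorem pathOf_last_eq_iff {k i : ℕ} (hik : i ≤ k) (y : Fin k → ℤ) (a : Fin i → Fin k) :
    pathOf y a (Fin.last i) = y + eVec k i ↔ ∀ c : Fin k, (c : ℕ) < i → c ∈ Set.range a := by
  classical
  constructor
  · intro h c hc
    by_contra hca
    have := congrFun h c
    rw [pathOf_last, if_neg hca] at this
    simp [eVec, hc] at this
  · intro h
    funext c
    rw [pathOf_last, Pi.add_apply, eVec]
    simp only [mem_range_iff_of_forall_lt hik h c]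

theorem pathOf_last_eq_or_lexLt {k i : ℕ} (hik : i ≤ k) (y : Fin k → ℤ) (a : Fin i → Fin k) :
    pathOf y a (Fin.last i) = y + eVec k i ∨
      LexLt (pathOf y a (Fin.last i)) (y + eVec k i) := by
  classical
  rw [pathOf_last_eq_iff hik, or_iff_not_imp_left]
  intro h
  push Not at h
  obtain ⟨c, ⟨hci, hca⟩, hmin⟩ := exists_minimal_of_wellFoundedLT
    (fun c : Fin k => (c : ℕ) < i ∧ c ∉ Set.range a) h
  refine ⟨c, ?_, fun d hd => ?_⟩
  · rw [pathOf_last, if_neg hca]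
    simp [eVec, hci]
  · have hdi : (d : ℕ) < i := lt_trans hd hci
    have hda : d ∈ Set.range a := by
      by_contra hda
      exact absurd (hmin ⟨hdi, hda⟩ hd.le) (not_le_of_gt hd)
    rw [pathOf_last, if_pos hda]
    simp [eVec, hdi]

theorem ncard_pathSet_le {k l i n : ℕ} {hk : 0 < k} (hl : 2 ≤ l) {y : Fin k → ℤ}
    (hcount : (Finset.univ.filter fun j : Fin k =>
      y j % (l : ℤ) = y ⟨0, hk⟩ % (l : ℤ)).card = n) :
    (PathSet k l i hk y).ncard ≤ n.descFactorial i := by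
  set S := Finset.univ.filter fun j : Fin k => y j % (l : ℤ) = y ⟨0, hk⟩ % (l : ℤ) with hS
  have hsub : PathSet k l i hk y ⊆
      Set.range fun f : Fin i ↪ S => pathOf y fun t => (f t : Fin k) := by
    intro p hp
    obtain ⟨a, ha, hmod, rfl⟩ := exists_eq_pathOf hl hp
    exact ⟨⟨fun t => ⟨a t, Finset.mem_filter.2 ⟨Finset.mem_univ _, hmod t⟩⟩,
      fun s t hst => ha (congrArg Subtype.val hst)⟩, rfl⟩
  calc (PathSet k l i hk y).ncard
      ≤ (Set.range fun f : Fin i ↪ S => pathOf y fun t => (f t : Fin k)).ncard :=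
        Set.ncard_le_ncard hsub (Set.finite_range _)
    _ ≤ Nat.card (Fin i ↪ S) := by
        rw [← Set.image_univ, ← Set.ncard_univ]
        exact Set.ncard_image_le
    _ = n.descFactorial i := by
        rw [Nat.card_eq_fintype_card, Fintype.card_embedding_eq, Fintype.card_coe, hcount,
          Fintype.card_fin]

theorem ncard_pathSet_last_eq {k l i : ℕ} {hk : 0 < k} (hl : 2 ≤ l) (hik : i ≤ k)
    {y : Fin k → ℤ} (hdom : Dominant y)
    (hfirst : ∀ j : Fin k, (j : ℕ) < i → y j ≡ y ⟨0, hk⟩ [ZMOD (l : ℤ)]) :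
    {p ∈ PathSet k l i hk y | p (Fin.last i) = y + eVec k i}.ncard = Nat.factorial i := by
  have hinj : ∀ σ : Equiv.Perm (Fin i), Function.Injective (Fin.castLE hik ∘ σ) :=
    fun σ => (Fin.castLE_injective hik).comp σ.injective
  have heq : {p ∈ PathSet k l i hk y | p (Fin.last i) = y + eVec k i} =
      Set.range fun σ : Equiv.Perm (Fin i) => pathOf y (Fin.castLE hik ∘ σ) := by
    ext p
    constructor
    · rintro ⟨hp, hlast⟩
      obtain ⟨a, ha, -, rfl⟩ := exists_eq_pathOf hl hp
      have hai : ∀ t, (a t : ℕ) < i := fun t =>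
        (mem_range_iff_of_forall_lt hik ((pathOf_last_eq_iff hik y a).1 hlast) _).1 ⟨t, rfl⟩
      have hb : Function.Injective fun t => (⟨a t, hai t⟩ : Fin i) := fun s t hst =>
        ha (Fin.ext (Fin.mk.inj hst))
      exact ⟨Equiv.ofBijective _ (Finite.injective_iff_bijective.1 hb), rfl⟩
    · rintro ⟨σ, rfl⟩
      refine ⟨pathOf_mem_pathSet hl hdom hfirst (hinj σ) fun t => (σ t).2,
        (pathOf_last_eq_iff hik y _).2 fun c hc => ⟨σ.symm ⟨c, hc⟩, ?_⟩⟩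
      simp
  rw [heq, ← Set.image_univ, Set.ncard_image_of_injective, Set.ncard_univ,
    Nat.card_eq_fintype_card, Fintype.card_perm, Fintype.card_fin]
  intro σ τ h
  have := pathOf_injOn y (hinj σ) (hinj τ) h
  exact Equiv.ext fun t => Fin.castLE_injective hik (congrFun this t)


/-- Let `y ∈ ℤ^k` be dominant, `i + m ≤ k`, suppose the first `i`
coordinates of `y` are `≡ y_1 mod l` and exactly `i + m` coordinates of `y` are
`≡ y_1 mod l`. Then (a) every path in `𝒫` ends at `y + e^{(i)}` or at a
lexicographically smaller point; (b) `|𝒫| ≤ (m+i)!/m!`; (c) exactly `i!` paths in `𝒫`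
end at `y + e^{(i)}`. -/
theorem stmt_13 (k l : ℕ) (hk : 0 < k) (hl : 2 ≤ l)
    (y : Fin k → ℤ) (hdom : Dominant y)
    (i m : ℕ) (him : i + m ≤ k)
    (hfirst : ∀ j : Fin k, (j : ℕ) < i → y j ≡ y ⟨0, hk⟩ [ZMOD (l : ℤ)])
    (hcount : (Finset.univ.filter fun j : Fin k =>
      y j % (l : ℤ) = y ⟨0, hk⟩ % (l : ℤ)).card = i + m) :
    (∀ p ∈ PathSet k l i hk y,
      p (Fin.last i) = y + eVec k i ∨ LexLt (p (Fin.last i)) (y + eVec k i)) ∧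
    (PathSet k l i hk y).ncard ≤ Nat.factorial (m + i) / Nat.factorial m ∧
    {p ∈ PathSet k l i hk y | p (Fin.last i) = y + eVec k i}.ncard = Nat.factorial i := by
  have hik : i ≤ k := by omega
  refine ⟨fun p hp => ?_, ?_, ncard_pathSet_last_eq hl hik hdom hfirst⟩
  · obtain ⟨a, -, -, rfl⟩ := exists_eq_pathOf hl hp
    exact pathOf_last_eq_or_lexLt hik y a
  · refine (ncard_pathSet_le hl hcount).trans_eq ?_
    rw [Nat.descFactorial_eq_div (Nat.le_add_right i m), Nat.add_sub_cancel_left, Nat.add_comm]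
end

section
/- Let l ≥ 2, k ≥ 2, m ≥ 1 be integers, let K be a field of characteristic 0 containing a primitive l-th root of unity q, and set n = m·l + (l−1)·k(k−1)/2. Let V = K^k, let A be the unital K-subalgebra of End_K(V^{⊗n}) generated by the operators R_1(q), …, R_{n−1}(q), and let B be the unital K-subalgebra of End_K(V^{⊗m}) generated by the flip operators P_1, …, P_{m−1}, where P_s interchanges the s-th and (s+1)-st tensor factors of V^{⊗m} (so B is the image of the group algebra K[S_m] acting on V^{⊗m} by permutation of the tensor factors, i.e., the k-row quotient of K[S_m]). Then there exists an injective K-linear map φ : B → A satisfying φ(b·b') = φ(b)·φ(b') for all b, b' ∈ B; that is, the k-row quotient of the Hecke algebra H_n(q) contains a (non-unital) K-subalgebra isomorphic to the k-row quotient of the group algebra of the symmetric group S_m. -/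
set_option maxHeartbeats 1000000
set_option synthInstance.maxHeartbeats 1000000

/-- Swap the values of `f : Fin n → Fin k` at the two positions `s` and `t`. -/
def swapAt (k n : ℕ) (s t : Fin n) (f : Fin n → Fin k) : Fin n → Fin k :=
  fun u => if u = s then f t else if u = t then f s else f u

/-- The matrix (in the standard basis of `V^{⊗n}`, `V = K^k`, with basis vectors
indexed by functions `Fin n → Fin k`) of the operator acting as Jimbo's `R`-matrix
with parameter `u` on the tensor factors in positions `s` and `t` and as the identity
elsewhere. -/
def RMat (K : Type*) [Field K] (u : K) (k n : ℕ) (s t : Fin n) :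
    Matrix (Fin n → Fin k) (Fin n → Fin k) K :=
  Matrix.of fun g f =>
    if f s = f t then (if g = f then u else 0)
    else if (f s : ℕ) < (f t : ℕ) then (if g = swapAt k n s t f then 1 else 0)
    else (if g = f then u - 1 else if g = swapAt k n s t f then u else 0)

/-- The matrix of the flip operator interchanging the tensor factors in positions `s`
and `t` of `V^{⊗m}`. -/
def FlipMat (K : Type*) [Field K] (k m : ℕ) (s t : Fin m) :
    Matrix (Fin m → Fin k) (Fin m → Fin k) K :=
  Matrix.of fun g f => if g = swapAt k m s t f then 1 else 0

/-- The operators `R_1(u), …, R_{n-1}(u)` on `V^{⊗n}`. -/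
def HeckeGens (K : Type*) [Field K] (u : K) (k n : ℕ) :
    Set (Module.End K ((Fin n → Fin k) → K)) :=
  {T | ∃ (s : ℕ) (h : s + 1 < n),
    T = (RMat K u k n ⟨s, Nat.lt_of_succ_lt h⟩ ⟨s + 1, h⟩).mulVecLin}

/-- The flip operators `P_1, …, P_{m-1}` on `V^{⊗m}`. -/
def FlipGens (K : Type*) [Field K] (k m : ℕ) :
    Set (Module.End K ((Fin m → Fin k) → K)) :=
  {T | ∃ (s : ℕ) (h : s + 1 < m),
    T = (FlipMat K k m ⟨s, Nat.lt_of_succ_lt h⟩ ⟨s + 1, h⟩).mulVecLin}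

/-- The `k`-row quotient of the Iwahori–Hecke algebra `H_n(u)`: the unital subalgebra
of `End_K(V^{⊗n})` generated by the operators `R_1(u), …, R_{n-1}(u)`. -/
def RowQuotient (K : Type*) [Field K] (u : K) (k n : ℕ) :
    Subalgebra K (Module.End K ((Fin n → Fin k) → K)) :=
  Algebra.adjoin K (HeckeGens K u k n)

/-- The `k`-row quotient of the group algebra `K[S_m]`: the unital subalgebra of
`End_K(V^{⊗m})` generated by the flips `P_1, …, P_{m-1}`, i.e. the image of `K[S_m]`
acting on `V^{⊗m}` by permutation of the tensor factors. -/
def SymRowQuotient (K : Type*) [Field K] (k m : ℕ) :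
    Subalgebra K (Module.End K ((Fin m → Fin k) → K)) :=
  Algebra.adjoin K (FlipGens K k m)

theorem exists_isIdempotentElem_mem_ker_mul_mem_jacobson {C B : Type*} [Ring C]
    [IsArtinianRing C] [Ring B] [IsSemisimpleRing B] (π : C →+* B) (hπ : Function.Surjective π) :
    ∃ e : C, IsIdempotentElem e ∧ π e = 0 ∧
      ∀ x, π x = 0 → x * (1 - e) ∈ Ring.jacobson C := by
  have hJ : ∀ x ∈ Ring.jacobson C, π x = 0 := by
    intro x hx
    have : RingHomSurjective π := ⟨hπ⟩
    have h := Ring.le_comap_jacobson π hx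
    rwa [IsSemisimpleRing.jacobson_eq_bot, Ideal.mem_comap, Ideal.mem_bot] at h
  let mk := Ideal.Quotient.mk (Ring.jacobson C)
  have hmk : Function.Surjective mk := Ideal.Quotient.mk_surjective
  obtain ⟨e', he', hI⟩ :=
    IsSemisimpleRing.ideal_eq_span_idempotent (Ideal.map mk (RingHom.ker π))
  obtain ⟨e, he, rfl⟩ := exists_isIdempotentElem_eq_of_ker_isNilpotent mk (fun x hx => by
    obtain ⟨N, hN⟩ := IsSemiprimaryRing.isNilpotent (R := C)
    refine ⟨N, ?_⟩
    have := Ideal.pow_mem_pow (Ideal.Quotient.eq_zero_iff_mem.mp hx) N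
    rwa [hN] at this) e' (hmk e') he'
  refine ⟨e, he, ?_, fun x hx => ?_⟩
  · have : mk e ∈ Ideal.map mk (RingHom.ker π) := by
      rw [hI]; exact Ideal.subset_span rfl
    obtain ⟨y, hy, hye⟩ := (Ideal.mem_map_iff_of_surjective mk hmk).mp this
    have h := hJ _ (Ideal.Quotient.eq.mp hye)
    rw [map_sub, (RingHom.mem_ker).mp hy, zero_sub, neg_eq_zero] at h
    exact h
  · have : mk x ∈ Ideal.map mk (RingHom.ker π) := Ideal.mem_map_of_mem _ hx
    rw [hI] at this
    obtain ⟨c, hc⟩ := Ideal.mem_span_singleton'.mp this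
    refine Ideal.Quotient.eq_zero_iff_mem.mp ?_
    change mk (x * (1 - e)) = 0
    rw [map_mul, ← hc, map_sub, map_one, mul_assoc, mul_sub, mul_one, he'.eq, sub_self, mul_zero]

/-- A map `σ` from a finite group to an algebra that is multiplicative up to defects
`σ a * σ b - σ (a * b)` can be corrected so that the new defects are sums of products of two
of the old ones. -/
theorem averaged_defect {K C G : Type*} [Field K] [CharZero K] [Ring C] [Algebra K C] [Group G]
    [Fintype G] (σ : G → C) (hr : ∀ g, σ g * σ 1 = σ g)
    (c : G → G → C) (hc : ∀ a b, c a b = σ a * σ b - σ (a * b))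
    (γ : G → C) (hγ : ∀ b, γ b = (Fintype.card G : K)⁻¹ • ∑ h, c b h * σ h⁻¹) (a b : G) :
    (σ a - γ a) * (σ b - γ b) - (σ (a * b) - γ (a * b)) =
      γ a * γ b - c a b * ((Fintype.card G : K)⁻¹ • ∑ h, c h h⁻¹)
        - (Fintype.card G : K)⁻¹ • ∑ h, c a h * c h⁻¹ b := by
  have hcard : (Fintype.card G : K) ≠ 0 := by simp
  have hcr : c a b * σ 1 = c a b := by rw [hc, sub_mul, mul_assoc, hr, hr]
  have hcoc : ∀ h, σ a * c b h - c (a * b) h = c a b * σ h - c a (b * h) := by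
    intro h
    simp only [hc, mul_assoc]
    noncomm_ring
  have h1 : ∀ h, (σ a * c b h - c (a * b) h) * σ h⁻¹ =
      c a b + c a b * c h h⁻¹ - c a (b * h) * σ h⁻¹ := by
    intro h
    have : σ h * σ h⁻¹ = σ 1 + c h h⁻¹ := by rw [hc, mul_inv_cancel]; abel
    rw [hcoc, sub_mul, mul_assoc, this, mul_add, hcr]
  have h2 : ∑ h, c a (b * h) * σ h⁻¹ = ∑ h, c a h * σ (h⁻¹ * b) := by
    refine Fintype.sum_equiv (Equiv.mulLeft b) _ _ fun h => ?_
    simp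
  have h3 : ∀ h, c a h * σ (h⁻¹ * b) = c a h * σ h⁻¹ * σ b - c a h * c h⁻¹ b := by
    intro h
    have : σ (h⁻¹ * b) = σ h⁻¹ * σ b - c h⁻¹ b := by rw [hc]; abel
    rw [this, mul_sub, mul_assoc]
  have h4 : σ a * γ b - γ (a * b) = c a b + c a b * ((Fintype.card G : K)⁻¹ • ∑ h, c h h⁻¹)
      - γ a * σ b + (Fintype.card G : K)⁻¹ • ∑ h, c a h * c h⁻¹ b := by
    have : σ a * γ b - γ (a * b) =
        (Fintype.card G : K)⁻¹ • ∑ h, (σ a * c b h - c (a * b) h) * σ h⁻¹ := by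
      rw [hγ, hγ, mul_smul_comm, ← smul_sub, Finset.mul_sum, ← Finset.sum_sub_distrib]
      simp only [sub_mul, mul_assoc]
    rw [this, Finset.sum_congr rfl fun h _ => h1 h, Finset.sum_sub_distrib,
      Finset.sum_add_distrib, h2, Finset.sum_congr rfl fun h _ => h3 h, Finset.sum_sub_distrib,
      ← Finset.mul_sum, ← Finset.sum_mul, Finset.sum_const, Finset.card_univ, hγ a,
      ← Nat.cast_smul_eq_nsmul K]
    simp only [smul_sub, smul_add, smul_smul, inv_mul_cancel₀ hcard, one_smul, mul_smul_comm,
      smul_mul_assoc]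
    abel
  have h5 : (σ a - γ a) * (σ b - γ b) - (σ (a * b) - γ (a * b)) =
      c a b - γ a * σ b - (σ a * γ b - γ (a * b)) + γ a * γ b := by
    rw [hc]; noncomm_ring
  rw [h5, h4]
  abel

theorem exists_lift_mod_pow {K C B G : Type*} [Field K] [CharZero K] [Ring C] [Algebra K C]
    [Ring B] [Algebra K B] [Group G] [Fintype G] (π : C →ₐ[K] B)
    (hπ : Function.Surjective π) (ρ : G →* B) (J : Ideal C) [J.IsTwoSided]
    (hJ : ∀ x ∈ J, π x = 0) (f : C) (hf : IsIdempotentElem f) (hπf : π f = 1)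
    (hfJ : ∀ x, π x = 0 → x * f ∈ J) (r : ℕ) :
    ∃ σ : G → C, (∀ g, f * σ g = σ g) ∧ (∀ g, σ g * f = σ g) ∧ σ 1 = f ∧
      (∀ g, π (σ g) = ρ g) ∧ ∀ a b, σ a * σ b - σ (a * b) ∈ J ^ (r + 1) := by
  classical
  induction r with
  | zero =>
    choose s hs using hπ
    have hff : f * f = f := hf
    let σ : G → C := fun g => if g = 1 then f else f * s (ρ g) * f
    have hl : ∀ g, f * σ g = σ g := by
      intro g
      by_cases hg : g = 1 <;> simp [σ, hg, hff, ← mul_assoc]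
    have hr : ∀ g, σ g * f = σ g := by
      intro g
      by_cases hg : g = 1 <;> simp [σ, hg, hff, mul_assoc]
    have hp : ∀ g, π (σ g) = ρ g := by
      intro g
      by_cases hg : g = 1 <;> simp [σ, hg, hπf, hs]
    refine ⟨σ, hl, hr, by simp [σ], hp, fun a b => ?_⟩
    have h := hfJ (σ a * σ b - σ (a * b)) (by simp [hp])
    rw [zero_add, Submodule.pow_one]
    rwa [sub_mul, mul_assoc, hr, hr] at h
  | succ r ih =>
    obtain ⟨σ, hl, hr, h1, hp, hd⟩ := ih
    let c : G → G → C := fun a b => σ a * σ b - σ (a * b)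
    let κ : K := (Fintype.card G : K)⁻¹
    let γ : G → C := fun b => κ • ∑ h, c b h * σ h⁻¹
    have hsm : ∀ (I : Ideal C) (t : K) (x : C), x ∈ I → t • x ∈ I := fun I t x hx => by
      rw [Algebra.smul_def]; exact I.mul_mem_left _ hx
    have hγ : ∀ b, γ b ∈ J ^ (r + 1) := fun b =>
      hsm _ _ _ (Ideal.sum_mem _ fun h _ => Ideal.mul_mem_right _ _ (hd b h))
    have hpow : ∀ x ∈ J ^ (r + 1), ∀ y ∈ J ^ (r + 1), x * y ∈ J ^ (r + 1 + 1) := by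
      intro x hx y hy
      rw [Submodule.pow_succ]
      refine Ideal.mul_mem_mul hx ?_
      exact Ideal.pow_le_self (Nat.succ_ne_zero r) hy
    refine ⟨fun g => σ g - γ g, fun g => ?_, fun g => ?_, ?_, fun g => ?_, fun a b => ?_⟩
    · simp only [γ, c, mul_sub, hl, mul_smul_comm, Finset.mul_sum, sub_mul, ← mul_assoc]
    · simp only [γ, c, sub_mul, hr, smul_mul_assoc, Finset.sum_mul, mul_assoc]
    · have : ∀ h, c 1 h = 0 := fun h => by simp [c, h1, hl]
      simp [γ, this, h1]
    · rw [map_sub, hp, hJ _ (Ideal.pow_le_self (Nat.succ_ne_zero r) (hγ g)), sub_zero]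
    · change (σ a - γ a) * (σ b - γ b) - (σ (a * b) - γ (a * b)) ∈ _
      rw [averaged_defect (K := K) σ (fun g => by rw [h1, hr]) c (fun _ _ => rfl) γ
        (fun _ => rfl) a b]
      refine Ideal.sub_mem _ (Ideal.sub_mem _ ?_ ?_) ?_
      · exact hpow _ (hγ a) _ (hγ b)
      · exact hpow _ (hd a b) _ (hsm _ _ _ (Ideal.sum_mem _ fun h _ => hd _ _))
      · exact hsm _ _ _ (Ideal.sum_mem _ fun h _ => hpow _ (hd _ _) _ (hd _ _))

/-- A surjection from a finite-dimensional algebra onto a quotient of the group algebra of a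
finite group, in characteristic zero, has a multiplicative (not necessarily unital) section. -/
theorem exists_multiplicative_section {K C B G : Type*} [Field K] [CharZero K] [Ring C]
    [Algebra K C] [FiniteDimensional K C] [Ring B] [Algebra K B] [Group G] [Finite G]
    (π : C →ₐ[K] B) (hπ : Function.Surjective π)
    (ρ : MonoidAlgebra K G →ₐ[K] B) (hρ : Function.Surjective ρ) :
    ∃ φ : B →ₗ[K] C, (∀ b b', φ (b * b') = φ b * φ b') ∧ ∀ b, π (φ b) = b := by
  classical
  have := Fintype.ofFinite G
  have : IsArtinianRing C := IsArtinianRing.of_finite K C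
  have : NeZero (Nat.card G : K) := ⟨by simp⟩
  have hB : IsSemisimpleRing B := (ρ : MonoidAlgebra K G →+* B).isSemisimpleRing_of_surjective hρ
  obtain ⟨e, he, hπe, heJ⟩ :=
    exists_isIdempotentElem_mem_ker_mul_mem_jacobson (π : C →+* B) hπ
  have hJ : ∀ x ∈ Ring.jacobson C, π x = 0 := by
    intro x hx
    have : RingHomSurjective (π : C →+* B) := ⟨hπ⟩
    have h := Ring.le_comap_jacobson (π : C →+* B) hx
    rwa [IsSemisimpleRing.jacobson_eq_bot, Ideal.mem_comap, Ideal.mem_bot] at h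
  obtain ⟨N, hN⟩ := IsSemiprimaryRing.isNilpotent (R := C)
  replace hπe : π e = 0 := hπe
  obtain ⟨σ, hl, hr, h1, hp, hd⟩ := exists_lift_mod_pow π hπ
    ((ρ : MonoidAlgebra K G →* B).comp (MonoidAlgebra.of K G)) (Ring.jacobson C) hJ (1 - e)
    he.one_sub (by rw [map_sub, hπe, map_one, sub_zero]) heJ N
  have hmul : ∀ a b, σ (a * b) = σ a * σ b := by
    intro a b
    have := hd a b
    rw [Submodule.pow_succ, hN, zero_mul] at this
    exact (sub_eq_zero.mp this).symm
  let Φ : MonoidAlgebra K G →ₙₐ[K] C := MonoidAlgebra.liftMagma K ⟨σ, hmul⟩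
  have hΦ : ∀ x, π (Φ x) = ρ x := by
    have : (π : C →ₙₐ[K] B).comp Φ = (ρ : MonoidAlgebra K G →ₙₐ[K] B) := by
      refine MonoidAlgebra.nonUnitalAlgHom_ext K fun g => ?_
      change π (Φ (MonoidAlgebra.single g 1)) = ρ (MonoidAlgebra.single g 1)
      simp [Φ, hp]
    exact fun x => DFunLike.congr_fun this x
  have hΦr : ∀ x, Φ x * (1 - e) = Φ x := by
    have : ((LinearMap.mulRight K (1 - e)) ∘ₗ (Φ : MonoidAlgebra K G →ₗ[K] C)) =
        (Φ : MonoidAlgebra K G →ₗ[K] C) := by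
      refine MonoidAlgebra.lhom_ext' fun g => LinearMap.ext_ring ?_
      change Φ (MonoidAlgebra.single g 1) * (1 - e) = Φ (MonoidAlgebra.single g 1)
      simp [Φ, hr]
    exact fun x => DFunLike.congr_fun this x
  have hker : ∀ x, ρ x = 0 → Φ x = 0 := by
    intro x hx
    obtain ⟨ε, hε, hI⟩ := IsSemisimpleRing.ideal_eq_span_idempotent
      (RingHom.ker (ρ : MonoidAlgebra K G →+* B))
    have hερ : ρ ε = 0 := by
      have : ε ∈ RingHom.ker (ρ : MonoidAlgebra K G →+* B) := by
        rw [hI]; exact Ideal.subset_span rfl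
      exact this
    have hid : IsIdempotentElem (Φ ε) := by
      rw [IsIdempotentElem, ← map_mul, hε.eq]
    have hmem : Φ ε ∈ Ring.jacobson C := by
      rw [← hΦr]; exact heJ _ (by change π _ = 0; rw [hΦ, hερ])
    have hz : Φ ε = 0 := by
      have h := Ideal.pow_mem_pow hmem (N + 1)
      rw [Submodule.pow_succ, hN, zero_mul, hid.pow_succ_eq] at h
      exact h
    have hx' : x ∈ RingHom.ker (ρ : MonoidAlgebra K G →+* B) := hx
    rw [hI] at hx'
    obtain ⟨y, rfl⟩ := Ideal.mem_span_singleton'.mp hx'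
    rw [map_mul, hz, mul_zero]
  obtain ⟨s, hs⟩ := ρ.toLinearMap.exists_rightInverse_of_surjective
    (LinearMap.range_eq_top.mpr hρ)
  have hs' : ∀ b, ρ (s b) = b := fun b => DFunLike.congr_fun hs b
  refine ⟨(Φ : MonoidAlgebra K G →ₗ[K] C) ∘ₗ s, fun b b' => ?_, fun b => ?_⟩
  · change Φ (s (b * b')) = Φ (s b) * Φ (s b')
    rw [← map_mul, ← sub_eq_zero, ← map_sub]
    exact hker _ (by simp [hs'])
  · change π (Φ (s b)) = b
    rw [hΦ, hs']

/-- The product `a p * a (p + 1) * ⋯ * a (p + t - 1)`. -/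
def braidStage {M : Type*} [Monoid M] (a : ℕ → M) (p : ℕ) : ℕ → M
  | 0 => 1
  | t + 1 => braidStage a p t * a (p + t)

/-- The product of `r` stages of length `l` starting at `c`; for `r = l` this is the positive
braid interchanging two adjacent cables of `l` strands. -/
def cableSwap {M : Type*} [Monoid M] (a : ℕ → M) (c l : ℕ) : ℕ → M
  | 0 => 1
  | r + 1 => braidStage a (c + r) l * cableSwap a c l r

section Braid

variable {M : Type*} [Monoid M] {a : ℕ → M}

theorem braidStage_mul_comm (hcomm : ∀ i j, i + 2 ≤ j → a i * a j = a j * a i) {p t i : ℕ}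
    (h : i + 2 ≤ p ∨ p + t + 1 ≤ i) : braidStage a p t * a i = a i * braidStage a p t := by
  induction t with
  | zero => simp [braidStage]
  | succ t ih =>
    have h' : a (p + t) * a i = a i * a (p + t) := by
      rcases h with h | h
      · exact (hcomm _ _ (by omega)).symm
      · exact hcomm _ _ (by omega)
    rw [braidStage, mul_assoc, h', ← mul_assoc, ih (by omega), mul_assoc]

theorem braidStage_mul_shift {n : ℕ} (hcomm : ∀ i j, i + 2 ≤ j → a i * a j = a j * a i)
    (hbraid : ∀ i, i + 2 < n → a i * a (i + 1) * a i = a (i + 1) * a i * a (i + 1))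
    {p t i : ℕ} (hi : p ≤ i) (hit : i + 1 < p + t) (hn : p + t < n) :
    braidStage a p t * a i = a (i + 1) * braidStage a p t := by
  induction t with
  | zero => omega
  | succ t ih =>
    by_cases h : i + 1 < p + t
    · rw [braidStage, mul_assoc, ← hcomm i (p + t) (by omega), ← mul_assoc, ih h (by omega),
        mul_assoc]
    · obtain ⟨t, rfl⟩ : ∃ t', t = t' + 1 := ⟨t - 1, by omega⟩
      obtain rfl : i = p + t := by omega
      rw [braidStage, braidStage, ← add_assoc, mul_assoc, mul_assoc, ← mul_assoc (a (p + t)),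
        hbraid _ (by omega), ← mul_assoc, ← mul_assoc, braidStage_mul_comm hcomm (by omega)]
      simp only [mul_assoc]

theorem braidStage_mul_braidStage_mul {n : ℕ}
    (hcomm : ∀ i j, i + 2 ≤ j → a i * a j = a j * a i)
    (hbraid : ∀ i, i + 2 < n → a i * a (i + 1) * a i = a (i + 1) * a i * a (i + 1))
    {p t : ℕ} (ht : 1 ≤ t) (hn : p + t + 1 < n) :
    braidStage a (p + 1) t * braidStage a p t * a (p + t) =
      a p * (braidStage a (p + 1) t * braidStage a p t) := by
  induction t, ht using Nat.le_induction with
  | base =>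
    simp only [braidStage, one_mul, add_zero]
    rw [← hbraid p (by omega), mul_assoc]
  | succ t ht ih =>
    have h1 : p + 1 + t = p + t + 1 := by omega
    have h2 : p + (t + 1) = p + t + 1 := by omega
    calc braidStage a (p + 1) (t + 1) * braidStage a p (t + 1) * a (p + (t + 1))
        = braidStage a (p + 1) t * (a (p + t + 1) * braidStage a p t) *
            (a (p + t) * a (p + t + 1)) := by
          simp only [braidStage, mul_assoc, h1, h2]
      _ = braidStage a (p + 1) t * braidStage a p t *
            (a (p + t + 1) * a (p + t) * a (p + t + 1)) := by
          rw [← braidStage_mul_comm hcomm (by omega)]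
          simp only [mul_assoc]
      _ = braidStage a (p + 1) t * braidStage a p t * a (p + t) *
            (a (p + t + 1) * a (p + t)) := by
          rw [← hbraid _ (by omega)]
          simp only [mul_assoc]
      _ = a p * (braidStage a (p + 1) t * (braidStage a p t * a (p + t + 1)) * a (p + t)) := by
          rw [ih (by omega)]
          simp only [mul_assoc]
      _ = a p * (braidStage a (p + 1) (t + 1) * braidStage a p (t + 1)) := by
          rw [braidStage_mul_comm hcomm (by omega)]
          simp only [braidStage, mul_assoc, h1]

theorem cableSwap_mul_comm (hcomm : ∀ i j, i + 2 ≤ j → a i * a j = a j * a i) {c l r i : ℕ}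
    (h : i + 2 ≤ c ∨ c + r + l ≤ i) : cableSwap a c l r * a i = a i * cableSwap a c l r := by
  induction r with
  | zero => simp [cableSwap]
  | succ r ih =>
    rw [cableSwap, mul_assoc, ih (by omega), ← mul_assoc,
      braidStage_mul_comm hcomm (by omega), mul_assoc]

theorem cableSwap_mul_left {n : ℕ} (hcomm : ∀ i j, i + 2 ≤ j → a i * a j = a j * a i)
    (hbraid : ∀ i, i + 2 < n → a i * a (i + 1) * a i = a (i + 1) * a i * a (i + 1))
    {c l r i : ℕ} (hi : c ≤ i) (hil : i + 1 < c + l) (hn : c + l + r ≤ n) :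
    cableSwap a c l r * a i = a (i + r) * cableSwap a c l r := by
  induction r with
  | zero => simp [cableSwap]
  | succ r ih =>
    rw [cableSwap, mul_assoc, ih (by omega), ← mul_assoc,
      braidStage_mul_shift hcomm hbraid (by omega) (by omega) (by omega), mul_assoc, add_assoc]

theorem cableSwap_mul_right {n : ℕ} (hcomm : ∀ i j, i + 2 ≤ j → a i * a j = a j * a i)
    (hbraid : ∀ i, i + 2 < n → a i * a (i + 1) * a i = a (i + 1) * a i * a (i + 1))
    {c l r i : ℕ} (hi : c ≤ i) (hir : i + 2 ≤ c + r) (hl : 1 ≤ l) (hn : c + l + r ≤ n) :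
    cableSwap a c l r * a (i + l) = a i * cableSwap a c l r := by
  induction r with
  | zero => omega
  | succ r ih =>
    by_cases h : i + 2 ≤ c + r
    · rw [cableSwap, mul_assoc, ih h (by omega), ← mul_assoc,
        braidStage_mul_comm hcomm (by omega), mul_assoc]
    · obtain ⟨r, rfl⟩ : ∃ r', r = r' + 1 := ⟨r - 1, by omega⟩
      obtain rfl : i = c + r := by omega
      rw [cableSwap, cableSwap, mul_assoc, mul_assoc, cableSwap_mul_comm hcomm (by omega),
        ← mul_assoc, ← mul_assoc, ← add_assoc c r 1,
        braidStage_mul_braidStage_mul hcomm hbraid hl (by omega)]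
      simp only [mul_assoc]

end Braid

section Jimbo

variable {K : Type*} [Field K] {u : K} {k n : ℕ}

theorem swapAt_swapAt (s t : Fin n) (f : Fin n → Fin k) :
    swapAt k n s t (swapAt k n s t f) = f := by
  ext x
  by_cases hs : x = s <;> by_cases ht : x = t <;> by_cases hts : t = s <;>
    simp_all [swapAt]

theorem eq_swapAt_iff (s t : Fin n) (f g : Fin n → Fin k) :
    g = swapAt k n s t f ↔ f = swapAt k n s t g :=
  ⟨fun h => by rw [h, swapAt_swapAt], fun h => by rw [h, swapAt_swapAt]⟩

theorem swapAt_apply_left (s t : Fin n) (f : Fin n → Fin k) : swapAt k n s t f s = f t := by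
  simp [swapAt]

theorem swapAt_apply_right (s t : Fin n) (f : Fin n → Fin k) : swapAt k n s t f t = f s := by
  by_cases h : t = s <;> simp [swapAt, h]

theorem RMat_mulVecLin_apply (s t : Fin n) (v : (Fin n → Fin k) → K) (g : Fin n → Fin k) :
    (RMat K u k n s t).mulVecLin v g =
      if g s = g t then u * v g
      else if (g s : ℕ) < (g t : ℕ) then u * v (swapAt k n s t g)
      else (u - 1) * v g + v (swapAt k n s t g) := by
  have hcol : ∀ f, RMat K u k n s t g f =
      (if f = g then (if g s = g t then u else if (g s : ℕ) < (g t : ℕ) then 0 else u - 1)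
        else 0) +
      (if f = swapAt k n s t g then
        (if g s = g t then 0 else if (g s : ℕ) < (g t : ℕ) then u else 1) else 0) := by
    intro f
    by_cases hfg : f = g
    · subst hfg
      by_cases h1 : f s = f t
      · simp [RMat, h1]
      · have h2 : f ≠ swapAt k n s t f := fun h => h1 (by
          conv_lhs => rw [h, swapAt_apply_left])
        simp [RMat, h1, h2]
    · have hgf : g ≠ f := fun h => hfg h.symm
      by_cases h2 : g = swapAt k n s t f
      · have hs : f s = g t := by rw [h2, swapAt_apply_right]
        have ht : f t = g s := by rw [h2, swapAt_apply_left]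
        have h1 : ¬ g s = g t := by
          intro h
          apply hgf
          rw [h2]
          ext x
          by_cases hxs : x = s
          · subst hxs; rw [swapAt_apply_left, hs, ht, h]
          · by_cases hxt : x = t
            · subst hxt; rw [swapAt_apply_right, hs, ht, h]
            · simp [swapAt, hxs, hxt]
        have h1' : ¬ g t = g s := fun h => h1 h.symm
        have h1'' : (g s : ℕ) ≠ g t := fun h => h1 (Fin.ext h)
        rw [if_neg hfg, if_pos ((eq_swapAt_iff s t f g).mp h2), if_neg h1]
        simp only [RMat, Matrix.of_apply, hs, ht, if_neg h1', if_pos h2, if_neg hgf]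
        rcases lt_or_gt_of_ne h1'' with h | h
        · simp [h, not_lt_of_gt h]
        · simp [h, not_lt_of_gt h]
      · rw [if_neg hfg, if_neg (fun h => h2 ((eq_swapAt_iff s t f g).mpr h))]
        simp [RMat, hgf, h2]
  rw [Matrix.mulVecLin_apply, Matrix.mulVec, dotProduct]
  simp only [hcol, add_mul, ite_mul, zero_mul, Finset.sum_add_distrib, Finset.sum_ite_eq',
    Finset.mem_univ, if_true]
  split_ifs <;> simp

/-- The function `g` with its values at `s`, `t` and `r` replaced by `x`, `y` and `z`. -/
def replaceThree (s t r : Fin n) (g : Fin n → Fin k) (x y z : Fin k) : Fin n → Fin k :=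
  fun w => if w = s then x else if w = t then y else if w = r then z else g w

theorem RMat_braid {s t r : Fin n} (hst : s ≠ t) (htr : t ≠ r) (hsr : s ≠ r) :
    (RMat K u k n s t).mulVecLin * (RMat K u k n t r).mulVecLin * (RMat K u k n s t).mulVecLin =
      (RMat K u k n t r).mulVecLin * (RMat K u k n s t).mulVecLin *
        (RMat K u k n t r).mulVecLin := by
  refine LinearMap.ext fun v => funext fun g => ?_
  have hg : g = replaceThree s t r g (g s) (g t) (g r) := by
    ext w
    by_cases h1 : w = s
    · simp [replaceThree, h1]
    · by_cases h2 : w = t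
      · simp [replaceThree, h2, hst.symm]
      · by_cases h3 : w = r <;> simp [replaceThree, h1, h2, h3, hsr.symm, htr.symm]
  have hs : ∀ x y z, replaceThree s t r g x y z s = x := by simp [replaceThree]
  have ht : ∀ x y z, replaceThree s t r g x y z t = y := by simp [replaceThree, hst.symm]
  have hr : ∀ x y z, replaceThree s t r g x y z r = z := by
    simp [replaceThree, hsr.symm, htr.symm]
  have hsw1 : ∀ x y z, swapAt k n s t (replaceThree s t r g x y z) =
      replaceThree s t r g y x z := by
    intro x y z
    ext w
    by_cases h1 : w = s
    · subst h1; rw [swapAt_apply_left, ht, hs]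
    · by_cases h2 : w = t
      · subst h2; rw [swapAt_apply_right, ht, hs]
      · simp [swapAt, replaceThree, h1, h2]
  have hsw2 : ∀ x y z, swapAt k n t r (replaceThree s t r g x y z) =
      replaceThree s t r g x z y := by
    intro x y z
    ext w
    by_cases h1 : w = t
    · subst h1; rw [swapAt_apply_left, ht, hr]
    · by_cases h2 : w = r
      · subst h2; rw [swapAt_apply_right, ht, hr]
      · simp [swapAt, replaceThree, h1, h2]
  simp only [Module.End.mul_apply]
  rw [hg]
  generalize g s = x, g t = y, g r = z
  simp only [RMat_mulVecLin_apply, hs, ht, hr, hsw1, hsw2]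
  clear hg hs ht hr hsw1 hsw2
  rcases lt_trichotomy x y with h1 | h1 | h1 <;> rcases lt_trichotomy y z with h2 | h2 | h2 <;>
    rcases lt_trichotomy x z with h3 | h3 | h3 <;>
    first
    | (exfalso; omega)
    | (try subst h1)
      (try subst h2)
      (try subst h3)
      simp [*, ne_of_gt, ne_of_lt, not_lt_of_gt, Fin.val_fin_lt]
      try ring

theorem RMat_comm {s t s' t' : Fin n} (h1 : s ≠ s') (h2 : s ≠ t') (h3 : t ≠ s') (h4 : t ≠ t') :
    (RMat K u k n s t).mulVecLin * (RMat K u k n s' t').mulVecLin =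
      (RMat K u k n s' t').mulVecLin * (RMat K u k n s t).mulVecLin := by
  refine LinearMap.ext fun v => funext fun g => ?_
  have hs : ∀ f, swapAt k n s' t' f s = f s := by simp [swapAt, h1, h2]
  have ht : ∀ f, swapAt k n s' t' f t = f t := by simp [swapAt, h3, h4]
  have hs' : ∀ f, swapAt k n s t f s' = f s' := by simp [swapAt, h1.symm, h3.symm]
  have ht' : ∀ f, swapAt k n s t f t' = f t' := by simp [swapAt, h2.symm, h4.symm]
  have hsw : swapAt k n s' t' (swapAt k n s t g) = swapAt k n s t (swapAt k n s' t' g) := by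
    ext w
    by_cases e1 : w = s
    · subst e1; rw [hs, swapAt_apply_left, swapAt_apply_left, ht]
    · by_cases e2 : w = t
      · subst e2; rw [ht, swapAt_apply_right, swapAt_apply_right, hs]
      · by_cases e3 : w = s'
        · subst e3; rw [hs', swapAt_apply_left, swapAt_apply_left, ht']
        · by_cases e4 : w = t'
          · subst e4; rw [ht', swapAt_apply_right, swapAt_apply_right, hs']
          · simp [swapAt, e1, e2, e3, e4]
  simp only [Module.End.mul_apply, RMat_mulVecLin_apply, hs, ht, hs', ht', hsw]
  split_ifs <;> ring

end Jimbo

section Cable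

variable {K : Type*} [Field K] {u : K} {k n : ℕ}

/-- The operator `R_s(u)` of Jimbo's representation, acting on the tensor factors at `s` and
`s + 1`, extended by the identity to indices out of range. -/
def jimbo (u : K) (k n s : ℕ) : Module.End K ((Fin n → Fin k) → K) :=
  if h : s + 1 < n then (RMat K u k n ⟨s, Nat.lt_of_succ_lt h⟩ ⟨s + 1, h⟩).mulVecLin else 1

theorem jimbo_comm (i j : ℕ) (h : i + 2 ≤ j) :
    jimbo u k n i * jimbo u k n j = jimbo u k n j * jimbo u k n i := by
  unfold jimbo
  split_ifs with h1 h2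
  · refine RMat_comm ?_ ?_ ?_ ?_ <;> simp only [ne_eq, Fin.mk.injEq] <;> omega
  all_goals simp

theorem jimbo_braid (i : ℕ) (h : i + 2 < n) :
    jimbo u k n i * jimbo u k n (i + 1) * jimbo u k n i =
      jimbo u k n (i + 1) * jimbo u k n i * jimbo u k n (i + 1) := by
  have h1 : i + 1 < n := by omega
  simp only [jimbo, dif_pos h1, dif_pos (show i + 1 + 1 < n from h)]
  refine RMat_braid ?_ ?_ ?_ <;> simp only [ne_eq, Fin.mk.injEq] <;> omega

theorem jimbo_mem_rowQuotient (s : ℕ) : jimbo u k n s ∈ RowQuotient K u k n := by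
  unfold jimbo
  split_ifs with h
  · exact Algebra.subset_adjoin ⟨s, h, rfl⟩
  · exact one_mem _

theorem cableSwap_jimbo_mem_rowQuotient (c l r : ℕ) :
    cableSwap (jimbo u k n) c l r ∈ RowQuotient K u k n := by
  have hstage : ∀ p t, braidStage (jimbo u k n) p t ∈ RowQuotient K u k n := by
    intro p t
    induction t with
    | zero => exact one_mem _
    | succ t ih => exact mul_mem ih (jimbo_mem_rowQuotient _)
  induction r with
  | zero => exact one_mem _
  | succ r ih => exact mul_mem (hstage _ _) ih

/-- The standard basis vector of `V^{⊗n}` given by the first `n` letters of a word. -/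
def wordVec (K : Type*) [Field K] (n : ℕ) (w : ℕ → Fin k) : (Fin n → Fin k) → K :=
  Pi.single (fun x : Fin n => w x) 1

theorem jimbo_wordVec_of_eq {s : ℕ} (hs : s + 1 < n) {w : ℕ → Fin k} (h : w s = w (s + 1)) :
    jimbo u k n s (wordVec K n w) = u • wordVec K n w := by
  rw [jimbo, dif_pos hs, Matrix.mulVecLin_apply, wordVec, Matrix.mulVec_single_one]
  ext g
  simp [RMat, h, Pi.single_apply]

theorem swapAt_word {s : ℕ} (hs : s + 1 < n) {w w' : ℕ → Fin k}
    (h1 : w' s = w (s + 1)) (h2 : w' (s + 1) = w s)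
    (h3 : ∀ y, y ≠ s → y ≠ s + 1 → w' y = w y) :
    swapAt k n ⟨s, Nat.lt_of_succ_lt hs⟩ ⟨s + 1, hs⟩ (fun x => w x) = fun x : Fin n => w' x := by
  funext x
  by_cases e1 : (x : ℕ) = s
  · simp [swapAt, Fin.ext_iff, e1, h1]
  · by_cases e2 : (x : ℕ) = s + 1
    · simp [swapAt, Fin.ext_iff, e2, h2]
    · simp [swapAt, Fin.ext_iff, e1, e2, h3 x e1 e2]

theorem jimbo_wordVec_of_lt {s : ℕ} (hs : s + 1 < n) {w w' : ℕ → Fin k} (h : w s < w (s + 1))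
    (h1 : w' s = w (s + 1)) (h2 : w' (s + 1) = w s)
    (h3 : ∀ y, y ≠ s → y ≠ s + 1 → w' y = w y) :
    jimbo u k n s (wordVec K n w) = wordVec K n w' := by
  rw [jimbo, dif_pos hs, Matrix.mulVecLin_apply, wordVec, Matrix.mulVec_single_one]
  ext g
  simp [RMat, ne_of_lt h, h, swapAt_word hs h1 h2 h3, wordVec, Pi.single_apply]

theorem jimbo_wordVec_of_gt {s : ℕ} (hs : s + 1 < n) {w w' : ℕ → Fin k} (h : w (s + 1) < w s)
    (h1 : w' s = w (s + 1)) (h2 : w' (s + 1) = w s)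
    (h3 : ∀ y, y ≠ s → y ≠ s + 1 → w' y = w y) :
    jimbo u k n s (wordVec K n w) = (u - 1) • wordVec K n w + u • wordVec K n w' := by
  rw [jimbo, dif_pos hs, Matrix.mulVecLin_apply, wordVec, Matrix.mulVec_single_one]
  have hne : (fun x : Fin n => w x) ≠ fun x : Fin n => w' x := fun e => by
    have := congrFun e ⟨s, Nat.lt_of_succ_lt hs⟩
    simp only [h1] at this
    exact (ne_of_gt h) this
  ext g
  by_cases hg : g = fun x : Fin n => w x
  · simp [RMat, ne_of_gt h, not_lt_of_gt h, wordVec, hg, hne]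
  · simp [RMat, ne_of_gt h, not_lt_of_gt h, swapAt_word hs h1 h2 h3, wordVec, Pi.single_apply, hg]

/-- The span of the images of `R_s(u) - u`, for `s ∈ S`. -/
def symKer (u : K) (k n : ℕ) (S : Set ℕ) : Submodule K ((Fin n → Fin k) → K) :=
  ⨆ s ∈ S, LinearMap.range (jimbo u k n s - u • 1)

theorem jimbo_sub_mem_symKer {S : Set ℕ} {s : ℕ} (hs : s ∈ S) (v : (Fin n → Fin k) → K) :
    jimbo u k n s v - u • v ∈ symKer u k n S :=
  (le_iSup₂_of_le (f := fun s (_ : s ∈ S) => LinearMap.range (jimbo u k n s - u • 1)) s hs le_rfl)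
    ⟨v, rfl⟩

theorem symKer_le {S : Set ℕ} {P : Submodule K ((Fin n → Fin k) → K)}
    (h : ∀ s ∈ S, ∀ v, jimbo u k n s v - u • v ∈ P) : symKer u k n S ≤ P := by
  refine iSup₂_le fun s hs => ?_
  rintro _ ⟨v, rfl⟩
  exact h s hs v

theorem symKer_mono {S S' : Set ℕ} (h : S ⊆ S') : symKer u k n S ≤ symKer u k n S' :=
  symKer_le fun _ hs _ => jimbo_sub_mem_symKer (h hs) _

theorem symKer_le_comap {S S' : Set ℕ} (T : Module.End K ((Fin n → Fin k) → K))
    (h : ∀ s ∈ S, ∃ s' ∈ S', T * jimbo u k n s = jimbo u k n s' * T) :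
    symKer u k n S ≤ (symKer u k n S').comap T := by
  refine symKer_le fun s hs v => ?_
  obtain ⟨s', hs', e⟩ := h s hs
  have e' := LinearMap.congr_fun e v
  simp only [Module.End.mul_apply] at e'
  rw [Submodule.mem_comap, map_sub, map_smul, e']
  exact jimbo_sub_mem_symKer hs' _

/-- The word `w` with the letters in positions `p, …, p + l` replaced by `i`, except for
a letter `j` in position `p + a`. -/
def slideWord (w : ℕ → Fin k) (p l : ℕ) (i j : Fin k) (a : ℕ) : ℕ → Fin k :=
  fun y => if y = p + a then j else if p ≤ y ∧ y ≤ p + l then i else w y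

theorem slideWord_self (w : ℕ → Fin k) (p l : ℕ) (i j : Fin k) (a : ℕ) :
    slideWord w p l i j a (p + a) = j := if_pos rfl

theorem slideWord_ne (w : ℕ → Fin k) (p l : ℕ) (i j : Fin k) (a b : ℕ) (hb : b ≤ l)
    (hab : b ≠ a) : slideWord w p l i j a (p + b) = i := by
  rw [slideWord, if_neg (by omega), if_pos (by omega)]

theorem slideWord_succ (w : ℕ → Fin k) (p l : ℕ) (i j : Fin k) (a : ℕ) (y : ℕ)
    (h1 : y ≠ p + a) (h2 : y ≠ p + a + 1) :
    slideWord w p l i j a y = slideWord w p l i j (a + 1) y := by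
  rw [slideWord, slideWord, if_neg h1, if_neg (show y ≠ p + (a + 1) by omega)]

theorem braidStage_wordVec_const {w : ℕ → Fin k} {p t : ℕ} {i : Fin k} (ht : p + t < n)
    (h : ∀ b ≤ t, w (p + b) = i) :
    braidStage (jimbo u k n) p t (wordVec K n w) = u ^ t • wordVec K n w := by
  induction t with
  | zero => simp [braidStage]
  | succ t ih =>
    have e : w (p + t) = w (p + t + 1) := (h t (by omega)).trans (h (t + 1) le_rfl).symm
    rw [braidStage, Module.End.mul_apply, jimbo_wordVec_of_eq (by omega) e, map_smul,
      ih (by omega) fun b hb => h b (by omega), smul_smul, pow_succ']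

theorem braidStage_slideWord_of_lt {w : ℕ → Fin k} {p l t : ℕ} {i j : Fin k} (hl : p + l < n)
    (hij : i < j) (ht : t ≤ l) :
    braidStage (jimbo u k n) p t (wordVec K n (slideWord w p l i j t)) =
      wordVec K n (slideWord w p l i j 0) := by
  induction t with
  | zero => simp [braidStage]
  | succ t ih =>
    have e1 := slideWord_ne w p l i j (t + 1) t (by omega) (by omega)
    have e2 : slideWord w p l i j (t + 1) (p + t + 1) = j := slideWord_self ..
    rw [braidStage, Module.End.mul_apply, jimbo_wordVec_of_lt (w' := slideWord w p l i j t)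
      (by omega) (by rw [e1, e2]; exact hij) (by rw [e2, slideWord_self])
      (by rw [e1]; exact slideWord_ne w p l i j t (t + 1) ht (by omega))
      (slideWord_succ w p l i j t), ih (by omega)]

theorem jimbo_slideWord_of_gt {w : ℕ → Fin k} {p l a : ℕ} {i j : Fin k} (hl : p + l < n)
    (hij : j < i) (ha : a + 1 ≤ l) :
    jimbo u k n (p + a) (wordVec K n (slideWord w p l i j (a + 1))) =
      (u - 1) • wordVec K n (slideWord w p l i j (a + 1)) +
        u • wordVec K n (slideWord w p l i j a) := by
  have e1 := slideWord_ne w p l i j (a + 1) a (by omega) (by omega)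
  have e2 : slideWord w p l i j (a + 1) (p + a + 1) = j := slideWord_self ..
  exact jimbo_wordVec_of_gt (w' := slideWord w p l i j a)
      (by omega) (by rw [e1, e2]; exact hij) (by rw [e2, slideWord_self])
      (by rw [e1]; exact slideWord_ne w p l i j a (a + 1) ha (by omega))
      (slideWord_succ w p l i j a)

theorem braidStage_slideWord_of_gt {w : ℕ → Fin k} {p l t : ℕ} {i j : Fin k} (hl : p + l < n)
    (hij : j < i) (ht : t ≤ l) :
    braidStage (jimbo u k n) p t (wordVec K n (slideWord w p l i j t)) =
      u ^ t • wordVec K n (slideWord w p l i j 0) +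
        ((u - 1) * u ^ (t - 1)) •
          ∑ b ∈ Finset.range t, wordVec K n (slideWord w p l i j (b + 1)) := by
  induction t with
  | zero => simp [braidStage]
  | succ t ih =>
    rw [braidStage, Module.End.mul_apply, jimbo_slideWord_of_gt hl hij ht, map_add, map_smul,
      map_smul, ih (by omega), braidStage_wordVec_const (i := i) (by omega) fun b hb =>
        slideWord_ne w p l i j (t + 1) b (by omega) (by omega), Finset.sum_range_succ]
    rcases t with _ | t
    · simp [add_comm]
    · simp only [Nat.add_sub_cancel, smul_add, smul_smul, pow_succ]
      module

theorem braidStage_slideWord {w : ℕ → Fin k} {p l : ℕ} {i j : Fin k} (hl : p + l < n)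
    (hu : u ^ l = 1) (hsum : ∑ b ∈ Finset.range l, u ^ b = 0) :
    braidStage (jimbo u k n) p l (wordVec K n (slideWord w p l i j l)) -
      wordVec K n (slideWord w p l i j 0) ∈
        symKer u k n {s | p + 1 ≤ s ∧ s + 1 < p + 1 + l} := by
  rcases lt_trichotomy i j with h | rfl | h
  · rw [braidStage_slideWord_of_lt hl h le_rfl, sub_self]
    exact zero_mem _
  · have : ∀ a, a ≤ l → slideWord w p l i i a = fun y => if p ≤ y ∧ y ≤ p + l then i else w y := by
      intro a ha
      funext y
      by_cases hy : y = p + a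
      · simp [slideWord, hy, ha]
      · simp [slideWord, hy]
    rw [this l le_rfl, this 0 (Nat.zero_le _), braidStage_wordVec_const (i := i) hl
      fun b hb => by simp [hb], hu, one_smul, sub_self]
    exact zero_mem _
  · have key : ∀ b, b + 1 ≤ l → wordVec K n (slideWord w p l i j (b + 1)) -
        u ^ b • wordVec K n (slideWord w p l i j 1) ∈
          symKer u k n {s | p + 1 ≤ s ∧ s + 1 < p + 1 + l} := by
      intro b hb
      induction b with
      | zero => simp
      | succ b ih =>
        have h1 := jimbo_sub_mem_symKer (u := u) (S := {s | p + 1 ≤ s ∧ s + 1 < p + 1 + l})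
          (s := p + (b + 1)) (by simp only [Set.mem_ofPred_eq]; omega)
          (wordVec K n (slideWord w p l i j (b + 1 + 1)))
        rw [jimbo_slideWord_of_gt hl h hb] at h1
        have h2 := Submodule.sub_mem _ (Submodule.smul_mem _ u (ih (by omega))) h1
        convert h2 using 1
        rw [pow_succ]
        module
    rw [braidStage_slideWord_of_gt hl h le_rfl, hu, one_smul, add_sub_cancel_left]
    refine Submodule.smul_mem _ _ ?_
    have h3 := Submodule.sum_mem _ fun b (hb : b ∈ Finset.range l) =>
      key b (Finset.mem_range.mp hb)
    rwa [Finset.sum_sub_distrib, ← Finset.sum_smul, hsum, zero_smul, sub_zero] at h3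

/-- The word `w` with the letters in positions `c, …, c + 2 * l - 1` replaced by `j`, except
for `l` letters `i` starting in position `c + r`. -/
def cableWord (w : ℕ → Fin k) (c l : ℕ) (i j : Fin k) (r : ℕ) : ℕ → Fin k :=
  fun y => if c ≤ y ∧ y < c + 2 * l then (if c + r ≤ y ∧ y < c + r + l then i else j) else w y

theorem cableSwap_cableWord {w : ℕ → Fin k} {c l r : ℕ} {i j : Fin k} (hl : c + 2 * l ≤ n)
    (hu : u ^ l = 1) (hsum : ∑ b ∈ Finset.range l, u ^ b = 0) (hr : r ≤ l) :
    cableSwap (jimbo u k n) c l r (wordVec K n (cableWord w c l i j 0)) -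
      wordVec K n (cableWord w c l i j r) ∈
        symKer u k n {s | c + r ≤ s ∧ s + 1 < c + r + l} := by
  induction r with
  | zero => simp [cableSwap]
  | succ r ih =>
    have e1 : cableWord w c l i j r =
        slideWord (cableWord w c l i j r) (c + r) l i j l := by
      funext y
      unfold slideWord cableWord
      split_ifs <;> first | rfl | omega
    have e2 : cableWord w c l i j (r + 1) =
        slideWord (cableWord w c l i j r) (c + r) l i j 0 := by
      funext y
      unfold slideWord cableWord
      split_ifs <;> first | rfl | omega
    have h1 := braidStage_slideWord (u := u) (w := cableWord w c l i j r) (p := c + r) (i := i)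
      (j := j) (n := n) (by omega) hu hsum
    rw [← e1, ← e2] at h1
    have h2 := symKer_le_comap (u := u) (S := {s | c + r ≤ s ∧ s + 1 < c + r + l})
      (S' := {s | c + r + 1 ≤ s ∧ s + 1 < c + r + 1 + l}) (braidStage (jimbo u k n) (c + r) l)
      (fun s hs => ⟨s + 1, by simp only [Set.mem_ofPred_eq] at hs ⊢; omega,
        braidStage_mul_shift jimbo_comm jimbo_braid hs.1 hs.2 (by omega)⟩) (ih (by omega))
    rw [Submodule.mem_comap, map_sub] at h2
    have h3 := Submodule.add_mem _ h2 h1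
    rw [sub_add_sub_cancel] at h3
    exact h3

end Cable

section FlipRepresentation

variable {K : Type*} [Field K] {k m : ℕ}

theorem AlgHom.surjective_of_eq_adjoin {E A : Type*} [Semiring E] [Algebra K E] [Semiring A]
    [Algebra K A] {S : Subalgebra K E} {s : Set E} (hS : S = Algebra.adjoin K s) (f : A →ₐ[K] S)
    (h : ∀ x ∈ s, ∃ a, (f a : E) = x) : Function.Surjective f := by
  have : S ≤ (S.val.comp f).range := hS.trans_le (Algebra.adjoin_le fun x hx => h x hx)
  intro b
  obtain ⟨a, ha⟩ := this b.2
  exact ⟨a, Subtype.ext ha⟩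

theorem symRowQuotient_def : SymRowQuotient K k m = Algebra.adjoin K (FlipGens K k m) := rfl

theorem FlipMat_mulVecLin_apply (s t : Fin m) (v : (Fin m → Fin k) → K) (g : Fin m → Fin k) :
    (FlipMat K k m s t).mulVecLin v g = v (swapAt k m s t g) := by
  simp [FlipMat, Matrix.mulVec, dotProduct, eq_swapAt_iff s t _ g]

/-- The action of the symmetric group on `V^{⊗m}` by permutation of the tensor factors. -/
def permRep (K : Type*) [Field K] (k m : ℕ) :
    Equiv.Perm (Fin m) →* Module.End K ((Fin m → Fin k) → K) where
  toFun σ := LinearMap.funLeft K K fun f => f ∘ σ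
  map_one' := rfl
  map_mul' _ _ := rfl

theorem permRep_swap (s t : Fin m) :
    permRep K k m (Equiv.swap s t) = (FlipMat K k m s t).mulVecLin := by
  refine LinearMap.ext fun v => funext fun g => ?_
  rw [FlipMat_mulVecLin_apply]
  refine congrArg v (funext fun x => ?_)
  simp only [swapAt, Function.comp_apply, Equiv.swap_apply_def]
  split_ifs <;> rfl

theorem permRep_mem_symRowQuotient (σ : Equiv.Perm (Fin m)) :
    permRep K k m σ ∈ SymRowQuotient K k m := by
  rcases m with _ | m
  · rw [Subsingleton.elim σ 1, map_one]
    exact one_mem _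
  have h : σ ∈ Submonoid.closure
      (Set.range fun i : Fin m => Equiv.swap i.castSucc i.succ) := by
    rw [Equiv.Perm.mclosure_swap_castSucc_succ]
    trivial
  induction h using Submonoid.closure_induction with
  | mem x hx =>
    obtain ⟨i, rfl⟩ := hx
    refine Algebra.subset_adjoin ⟨i, by omega, ?_⟩
    exact permRep_swap _ _
  | one => rw [map_one]; exact one_mem _
  | mul x y _ _ hx hy => rw [map_mul]; exact mul_mem hx hy

theorem exists_surjective_monoidAlgebra_symRowQuotient :
    ∃ ρ : MonoidAlgebra K (Equiv.Perm (Fin m)) →ₐ[K] SymRowQuotient K k m,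
      Function.Surjective ρ := by
  let ρ₀ : Equiv.Perm (Fin m) →* SymRowQuotient K k m :=
    (permRep K k m).codRestrict (SymRowQuotient K k m) permRep_mem_symRowQuotient
  refine ⟨MonoidAlgebra.lift K _ _ ρ₀, AlgHom.surjective_of_eq_adjoin symRowQuotient_def _ ?_⟩
  rintro _ ⟨s, h, rfl⟩
  exact ⟨MonoidAlgebra.of K _ (Equiv.swap ⟨s, Nat.lt_of_succ_lt h⟩ ⟨s + 1, h⟩),
    (congrArg Subtype.val (MonoidAlgebra.lift_of ρ₀ _)).trans (permRep_swap _ _)⟩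

end FlipRepresentation

section Cabling

variable {K : Type*} [Field K] {u : K} {k l m n : ℕ} {z : Fin k}

/-- The word in which each letter of `I` is repeated `l` times, continued by the letter `z`. -/
def blockWord (l : ℕ) (z : Fin k) (I : Fin m → Fin k) : ℕ → Fin k :=
  fun y => if h : y / l < m then I ⟨y / l, h⟩ else z

/-- The positions `s` such that `s` and `s + 1` lie in a common block of length `l`. -/
def blockInterior (l n : ℕ) : Set ℕ := {s | s + 1 < n ∧ ¬ l ∣ s + 1}

theorem blockWord_succ {s : ℕ} (hs : ¬ l ∣ s + 1) (I : Fin m → Fin k) :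
    blockWord l z I (s + 1) = blockWord l z I s := by
  simp [blockWord, Nat.succ_div, hs]

theorem blockWord_mul_add {s b : ℕ} (hs : s < m) (hb : b < l) (I : Fin m → Fin k) :
    blockWord l z I (l * s + b) = I ⟨s, hs⟩ := by
  have : (l * s + b) / l = s := by
    rw [Nat.mul_add_div (by omega), Nat.div_eq_of_lt hb, add_zero]
  simp [blockWord, this, hs]

theorem blockWord_injective (hl : 0 < l) (hn : m * l ≤ n) :
    Function.Injective fun (I : Fin m → Fin k) (x : Fin n) => blockWord l z I x := by
  intro I J h
  funext s
  have hs : l * s < n := by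
    have := Nat.mul_le_mul_right l (Nat.succ_le_of_lt s.2)
    rw [Nat.succ_mul, mul_comm] at this
    omega
  have e : ∀ J : Fin m → Fin k, blockWord l z J (l * s) = J s :=
    fun J => blockWord_mul_add s.2 hl J
  have h' := congrFun h ⟨l * s, hs⟩
  simpa only [e] using h'

/-- The embedding of `V^{⊗m}` into `V^{⊗n}` repeating each letter of a basis vector `l` times. -/
def cabling (K : Type*) [Field K] (l m n : ℕ) (z : Fin k) :
    ((Fin m → Fin k) → K) →ₗ[K] ((Fin n → Fin k) → K) :=
  Fintype.linearCombination K fun I => wordVec K n (blockWord l z I)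

theorem cabling_single (I : Fin m → Fin k) :
    cabling K l m n z (Pi.single I 1) = wordVec K n (blockWord l z I) := by
  simp [cabling, Fintype.linearCombination_apply_single]

theorem cabling_apply_blockWord (hl : 0 < l) (hn : m * l ≤ n) (v : (Fin m → Fin k) → K)
    (I : Fin m → Fin k) : cabling K l m n z v (fun x => blockWord l z I x) = v I := by
  simp [cabling, Fintype.linearCombination_apply, wordVec, Pi.single_apply,
    (blockWord_injective (z := z) hl hn).eq_iff]

theorem apply_blockWord_of_mem_symKer {v : (Fin n → Fin k) → K}
    (hv : v ∈ symKer u k n (blockInterior l n)) (I : Fin m → Fin k) :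
    v (fun x => blockWord l z I x) = 0 := by
  have : symKer u k n (blockInterior l n) ≤
      LinearMap.ker (LinearMap.proj (R := K) (φ := fun _ : Fin n → Fin k => K)
        fun x : Fin n => blockWord l z I x) := by
    refine symKer_le fun s hs v => ?_
    rw [LinearMap.mem_ker, LinearMap.proj_apply, Pi.sub_apply, jimbo, dif_pos hs.1,
      RMat_mulVecLin_apply, if_pos (blockWord_succ hs.2 I).symm, Pi.smul_apply, smul_eq_mul,
      sub_self]
  exact this hv

theorem eq_zero_of_cabling_mem_symKer (hl : 0 < l) (hn : m * l ≤ n) {v : (Fin m → Fin k) → K}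
    (hv : cabling K l m n z v ∈ symKer u k n (blockInterior l n)) : v = 0 := by
  funext I
  rw [← cabling_apply_blockWord (z := z) hl hn v I, apply_blockWord_of_mem_symKer hv I]
  rfl

theorem symKer_blockInterior_le_comap_cableSwap (hl : 0 < l) {s : ℕ} (hs : l * s + 2 * l ≤ n) :
    symKer u k n (blockInterior l n) ≤
      (symKer u k n (blockInterior l n)).comap (cableSwap (jimbo u k n) (l * s) l l) := by
  refine symKer_le_comap _ fun i hi => ?_
  obtain ⟨hin, hil⟩ := hi
  have h0 : i + 1 ≠ l * s := fun h => hil (h ▸ dvd_mul_right ..)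
  have h1 : i + 1 ≠ l * s + l := fun h => hil (h ▸ Dvd.intro (s + 1) (by ring))
  have h2 : i + 1 ≠ l * s + l + l := fun h => hil (h ▸ Dvd.intro (s + 2) (by ring))
  rcases lt_or_ge (i + 1) (l * s) with h | h
  · exact ⟨i, ⟨hin, hil⟩, cableSwap_mul_comm jimbo_comm (Or.inl (by omega))⟩
  rcases lt_or_ge (i + 1) (l * s + l) with h' | h'
  · refine ⟨i + l, ⟨by omega, ?_⟩,
      cableSwap_mul_left jimbo_comm jimbo_braid (by omega) h' (by omega)⟩
    rwa [add_right_comm, Nat.dvd_add_self_right]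
  rcases lt_or_ge (i + 1) (l * s + l + l) with h'' | h''
  · obtain ⟨j, rfl⟩ : ∃ j, i = j + l := ⟨i - l, by omega⟩
    refine ⟨j, ⟨by omega, ?_⟩,
      cableSwap_mul_right jimbo_comm jimbo_braid (by omega) (by omega) hl (by omega)⟩
    rwa [add_right_comm, Nat.dvd_add_self_right] at hil
  · exact ⟨i, ⟨hin, hil⟩, cableSwap_mul_comm jimbo_comm (Or.inr (by omega))⟩

theorem blockWord_swapAt (hl : 0 < l) {s : ℕ} (hs : s + 1 < m) (I : Fin m → Fin k) {i j : Fin k}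
    (hi : I ⟨s, Nat.lt_of_succ_lt hs⟩ = i) (hj : I ⟨s + 1, hs⟩ = j) :
    blockWord l z I = cableWord (blockWord l z I) (l * s) l i j 0 ∧
    blockWord l z (swapAt k m ⟨s, Nat.lt_of_succ_lt hs⟩ ⟨s + 1, hs⟩ I) =
      cableWord (blockWord l z I) (l * s) l i j l := by
  have key : ∀ J : Fin m → Fin k, ∀ y, l * s + l ≤ y → y < l * s + 2 * l →
      blockWord l z J y = J ⟨s + 1, hs⟩ := by
    intro J y h1 h2
    obtain ⟨b, rfl⟩ := Nat.exists_eq_add_of_le h1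
    rw [← Nat.mul_succ]
    exact blockWord_mul_add hs (by omega) J
  have key' : ∀ J : Fin m → Fin k, ∀ y, l * s ≤ y → y < l * s + l →
      blockWord l z J y = J ⟨s, Nat.lt_of_succ_lt hs⟩ := by
    intro J y h1 h2
    obtain ⟨b, rfl⟩ := Nat.exists_eq_add_of_le h1
    exact blockWord_mul_add _ (by omega) J
  constructor
  · funext y
    unfold cableWord
    split_ifs with h1 h2
    · rw [key' I y (by omega) (by omega), hi]
    · rw [key I y (by omega) (by omega), hj]
    · rfl
  · funext y
    unfold cableWord
    split_ifs with h1 h2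
    · rw [key _ y (by omega) (by omega), swapAt_apply_right, hi]
    · rw [key' _ y (by omega) (by omega), swapAt_apply_left, hj]
    · unfold blockWord
      split_ifs with h
      · have hy := Nat.div_add_mod y l
        have hlt := Nat.mod_lt y hl
        have h3 : y / l ≠ s := by
          intro e
          rw [e] at hy
          omega
        have h4 : y / l ≠ s + 1 := by
          intro e
          rw [e, Nat.mul_succ] at hy
          omega
        simp [swapAt, Fin.ext_iff, h3, h4]
      · rfl

theorem FlipMat_mulVecLin_single (s t : Fin m) (I : Fin m → Fin k) :
    (FlipMat K k m s t).mulVecLin (Pi.single I 1) = Pi.single (swapAt k m s t I) 1 := by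
  funext g
  rw [FlipMat_mulVecLin_apply, Pi.single_apply, Pi.single_apply]
  exact if_congr (eq_comm.trans (eq_swapAt_iff ..)) rfl rfl

theorem cableSwap_cabling (hl : 0 < l) (hn : m * l ≤ n) (hu : u ^ l = 1)
    (hsum : ∑ b ∈ Finset.range l, u ^ b = 0) {s : ℕ} (hs : s + 1 < m)
    (v : (Fin m → Fin k) → K) :
    cableSwap (jimbo u k n) (l * s) l l (cabling K l m n z v) -
      cabling K l m n z
        ((FlipMat K k m ⟨s, Nat.lt_of_succ_lt hs⟩ ⟨s + 1, hs⟩).mulVecLin v) ∈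
          symKer u k n (blockInterior l n) := by
  have hsn : l * s + 2 * l ≤ n := by
    have := Nat.mul_le_mul_right l (show s + 2 ≤ m from hs)
    rw [add_mul, mul_comm s] at this
    omega
  rw [← Submodule.Quotient.eq]
  revert v
  refine LinearMap.congr_fun (f := (symKer u k n (blockInterior l n)).mkQ ∘ₗ
    cableSwap (jimbo u k n) (l * s) l l ∘ₗ cabling K l m n z)
    (g := (symKer u k n (blockInterior l n)).mkQ ∘ₗ cabling K l m n z ∘ₗ
      (FlipMat K k m ⟨s, Nat.lt_of_succ_lt hs⟩ ⟨s + 1, hs⟩).mulVecLin)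
    ((Pi.basisFun K (Fin m → Fin k)).ext fun I => ?_)
  obtain ⟨e1, e2⟩ := blockWord_swapAt (z := z) hl hs I rfl rfl
  simp only [LinearMap.comp_apply, Pi.basisFun_apply, FlipMat_mulVecLin_single, cabling_single,
    Submodule.mkQ_apply]
  rw [Submodule.Quotient.eq, e2]
  nth_rewrite 1 [e1]
  refine symKer_mono (fun i hi => ?_) (cableSwap_cableWord hsn hu hsum le_rfl)
  obtain ⟨hi1, hi2⟩ := hi
  refine ⟨by omega, fun hd => ?_⟩
  rw [← Nat.mul_succ, Nat.succ_eq_add_one] at hi1 hi2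
  have h1 : i + 1 = l * (s + 1) + (i + 1 - l * (s + 1)) := by omega
  rw [h1, Nat.dvd_add_right (dvd_mul_right ..)] at hd
  have := Nat.le_of_dvd (by omega) hd
  omega

/-- The pairs of endomorphisms that are intertwined by the cabling map modulo `symKer`. -/
def cablingIntertwiners (u : K) (l m n : ℕ) (z : Fin k) :
    Subalgebra K (Module.End K ((Fin n → Fin k) → K) × Module.End K ((Fin m → Fin k) → K)) where
  carrier := {p | symKer u k n (blockInterior l n) ≤
      (symKer u k n (blockInterior l n)).comap p.1 ∧
    ∀ v, p.1 (cabling K l m n z v) - cabling K l m n z (p.2 v) ∈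
      symKer u k n (blockInterior l n)}
  mul_mem' {p p'} h h' := by
    refine ⟨fun v hv => h.1 (h'.1 hv), fun v => ?_⟩
    have h1 := h.1 (h'.2 v)
    rw [Submodule.mem_comap, map_sub] at h1
    have h2 := Submodule.add_mem _ h1 (h.2 (p'.2 v))
    rwa [sub_add_sub_cancel] at h2
  add_mem' {p p'} h h' := by
    refine ⟨fun v hv => Submodule.add_mem (symKer u k n (blockInterior l n)) (h.1 hv) (h'.1 hv),
      fun v => ?_⟩
    have h1 := Submodule.add_mem _ (h.2 v) (h'.2 v)
    rw [← add_sub_add_comm, ← map_add] at h1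
    exact h1
  algebraMap_mem' c := by
    refine ⟨fun v hv => Submodule.smul_mem _ c hv, fun v => ?_⟩
    have : c • cabling K l m n z v - cabling K l m n z (c • v) = 0 := by
      rw [map_smul, sub_self]
    exact this ▸ zero_mem _

/-- The pairs in `cablingIntertwiners` with components in the `k`-row quotients of the Hecke
algebra and of the group algebra of the symmetric group. -/
def cablingPairs (u : K) (l m n : ℕ) (z : Fin k) :
    Subalgebra K (Module.End K ((Fin n → Fin k) → K) × Module.End K ((Fin m → Fin k) → K)) :=
  (RowQuotient K u k n).prod (SymRowQuotient K k m) ⊓ cablingIntertwiners u l m n z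

/-- The projection of `cablingPairs` to the `k`-row quotient of the Hecke algebra. -/
def cablingPairsFst (u : K) (l m n : ℕ) (z : Fin k) :
    cablingPairs u l m n z →ₐ[K] RowQuotient K u k n :=
  ((AlgHom.fst K _ _).comp (cablingPairs u l m n z).val).codRestrict _ fun p => p.2.1.1

/-- The projection of `cablingPairs` to the `k`-row quotient of the symmetric group. -/
def cablingPairsSnd (u : K) (l m n : ℕ) (z : Fin k) :
    cablingPairs u l m n z →ₐ[K] SymRowQuotient K k m :=
  ((AlgHom.snd K _ _).comp (cablingPairs u l m n z).val).codRestrict _ fun p => p.2.1.2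

theorem cablingPairsSnd_surjective (hl : 0 < l) (hn : m * l ≤ n) (hu : u ^ l = 1)
    (hsum : ∑ b ∈ Finset.range l, u ^ b = 0) :
    Function.Surjective (cablingPairsSnd u l m n z) := by
  refine AlgHom.surjective_of_eq_adjoin symRowQuotient_def _ ?_
  rintro _ ⟨s, h, rfl⟩
  have hsn : l * s + 2 * l ≤ n := by
    have := Nat.mul_le_mul_right l (show s + 2 ≤ m from h)
    rw [add_mul, mul_comm s] at this
    omega
  exact ⟨⟨(cableSwap (jimbo u k n) (l * s) l l,
      (FlipMat K k m ⟨s, Nat.lt_of_succ_lt h⟩ ⟨s + 1, h⟩).mulVecLin),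
    ⟨cableSwap_jimbo_mem_rowQuotient (l * s) l l, Algebra.subset_adjoin ⟨s, h, rfl⟩⟩,
    symKer_blockInterior_le_comap_cableSwap hl hsn, cableSwap_cabling hl hn hu hsum h⟩, rfl⟩

theorem exists_cablingPairsSnd_section [CharZero K] (hl : 0 < l) (hn : m * l ≤ n)
    (hu : u ^ l = 1) (hsum : ∑ b ∈ Finset.range l, u ^ b = 0) :
    ∃ φ : SymRowQuotient K k m →ₗ[K] cablingPairs u l m n z,
      (∀ b b', φ (b * b') = φ b * φ b') ∧ ∀ b, cablingPairsSnd u l m n z (φ b) = b := by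
  obtain ⟨ρ, hρ⟩ := exists_surjective_monoidAlgebra_symRowQuotient (K := K) (k := k) (m := m)
  exact exists_multiplicative_section (C := cablingPairs u l m n z) (B := SymRowQuotient K k m)
    (G := Equiv.Perm (Fin m)) (cablingPairsSnd u l m n z)
    (cablingPairsSnd_surjective hl hn hu hsum) ρ hρ

end Cabling

/-- Let `q ∈ K` be a primitive `l`-th root of unity and
`n = m·l + (l-1)·k(k-1)/2`. Then the `k`-row quotient of the Hecke algebra `H_n(q)`
contains a (non-unital) subalgebra isomorphic to the `k`-row quotient of the group
algebra of the symmetric group `S_m`: there is an injective `K`-linear multiplicative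
map from the latter into the former. -/
theorem stmt_16 (K : Type*) [Field K] [CharZero K]
    (k l m n : ℕ) (hk : 2 ≤ k) (hl : 2 ≤ l) (hm : 1 ≤ m)
    (q : K) (hq : q ^ l = 1) (hq' : ∀ j : ℕ, 1 ≤ j → j < l → q ^ j ≠ 1)
    (hn : n = m * l + (l - 1) * (k * (k - 1) / 2)) :
    ∃ φ : SymRowQuotient K k m →ₗ[K] RowQuotient K q k n,
      Function.Injective φ ∧ ∀ b b', φ (b * b') = φ b * φ b' := by
  have hl0 : 0 < l := by omega
  have hnl : m * l ≤ n := hn ▸ Nat.le_add_right ..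
  have hq1 : q - 1 ≠ 0 := sub_ne_zero.mpr fun h => hq' 1 le_rfl (by omega) (by simp [h])
  have hsum : ∑ b ∈ Finset.range l, q ^ b = 0 := by
    refine (mul_eq_zero.mp ?_).resolve_right hq1
    rw [geom_sum_mul, hq, sub_self]
  let z : Fin k := ⟨0, by omega⟩
  obtain ⟨φ, hmul, hφ⟩ := exists_cablingPairsSnd_section (z := z) hl0 hnl hq hsum
  refine ⟨(cablingPairsFst q l m n z).toLinearMap ∘ₗ φ,
    (injective_iff_map_eq_zero _).mpr fun b hb => ?_, fun b b' => ?_⟩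
  · refine Subtype.ext (LinearMap.ext fun v => ?_)
    have h1 : (φ b).1.1 = 0 := congrArg Subtype.val hb
    have h2 : (φ b).1.2 = b := congrArg Subtype.val (hφ b)
    have h3 := (φ b).2.2.2 v
    rw [h1, h2, LinearMap.zero_apply, zero_sub, Submodule.neg_mem_iff] at h3
    exact eq_zero_of_cabling_mem_symKer hl0 hnl h3
  · simp only [LinearMap.comp_apply, AlgHom.toLinearMap_apply, hmul, map_mul]
end
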